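/- arXiv:1602.08179 — 7 statements merged into one kernel-verified Lean document; each statement's English description precedes it below -/
import Mathlib

section
/- Let 𝔫 be a finite alphabet and let T** ⊆ K(𝔫^ℤ) be the standard Borel space of Toeplitz subshifts over 𝔫 that have growing blocks with respect to the natural factorization of their scale. The topological conjugacy relation on T** is Borel reducible to E_1: there is a Borel map f from T** to (2^ℕ)^ℕ such that O and O' are topologically conjugate if and only if f(O) E_1 f(O'). -/
open Filter Topology TopologicalSpace Set

/- Endow the product space `𝔫^ℤ` with (a) metric compatible with the product topology, so
that the hyperspace `K(𝔫^ℤ)` carries the Hausdorff metric topology. -/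
attribute [local instance] PiCountable.metricSpace

/-- The Borel σ-algebra on the hyperspace `K(𝔫^ℤ)`. -/
noncomputable local instance (A : Type) [MetricSpace A] :
    MeasurableSpace (NonemptyCompacts (ℤ → A)) := borel _

/-- The left-shift map on bi-infinite sequences. -/
def shiftMap (A : Type) (x : ℤ → A) : ℤ → A := fun i => x (i + 1)

/-- `Per p x` is the set of indices `i` at which `x` is periodic with period `p`. -/
def Per (A : Type) (p : ℕ) (x : ℤ → A) : Set ℤ := {i : ℤ | ∀ k : ℤ, x (i + p * k) = x i}

/-- A sequence is periodic if it is invariant under shifting by some `p ≥ 1`. -/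
def IsPeriodicSeq (A : Type) (x : ℤ → A) : Prop := ∃ p : ℕ, 1 ≤ p ∧ ∀ i : ℤ, x (i + p) = x i

/-- A (non-periodic) Toeplitz sequence: every symbol occurs periodically. -/
def IsToeplitzSeq (A : Type) (x : ℤ → A) : Prop :=
  ¬ IsPeriodicSeq A x ∧ ∀ i : ℤ, ∃ j : ℕ, 1 ≤ j ∧ ∀ k : ℤ, x (i + k * j) = x i

/-- `p` is an essential period of `x`. -/
def IsEssentialPeriod (A : Type) (x : ℤ → A) (p : ℕ) : Prop :=
  1 ≤ p ∧ (Per A p x).Nonempty ∧ ∀ q : ℕ, 1 ≤ q → q < p → Per A p x ≠ Per A q x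

/-- The closure of the forward `σ`-orbit of `x`. -/
def orbitClosure (A : Type) [TopologicalSpace A] (x : ℤ → A) : Set (ℤ → A) :=
  closure {y | ∃ n : ℕ, y = (shiftMap A)^[n] x}

/-- Topological conjugacy of two subshifts: a shift-commuting homeomorphism. -/
def IsTopConj (A : Type) [TopologicalSpace A] (O O' : Set (ℤ → A)) : Prop :=
  ∃ e : O ≃ₜ O', ∀ x y : O, (y : ℤ → A) = shiftMap A (x : ℤ → A) →
    (e y : ℤ → A) = shiftMap A (e x : ℤ → A)


/-- The `t`-th term `ṙ_t = ∏_{1 ≤ i ≤ t+1} p_i^{min(k_i, t+1)}` of the approximating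
sequence to the scale of `x`, where `p_1 < p_2 < ⋯` are the primes and
`k_i = sup {j : p_i^j divides some essential period of x}`. -/
noncomputable def rdot (A : Type) (x : ℤ → A) (t : ℕ) : ℕ :=
  ∏ i ∈ Finset.range (t + 1),
    (Nat.nth Nat.Prime i) ^
      sSup {j : ℕ | j ≤ t + 1 ∧ ∃ e : ℕ, IsEssentialPeriod A x e ∧ (Nat.nth Nat.Prime i) ^ j ∣ e}

/-- The natural factorization of the scale of `x`: the sequence `(ṙ_t)` with all `1`'s and
all repeated terms deleted, i.e. the increasing enumeration of its set of values `≠ 1`. -/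
noncomputable def natFactorization (A : Type) (x : ℤ → A) : ℕ → ℕ :=
  Nat.nth fun m => m ≠ 1 ∧ ∃ t : ℕ, rdot A x t = m

/-- `x` has growing blocks with respect to `(u_i)`: the minimal length of a maximal block
of consecutive indices contained in `Per_{u_i}(x)` tends to `∞` with `i`. -/
def HasGrowingBlocks (A : Type) (x : ℤ → A) (u : ℕ → ℕ) : Prop :=
  ∀ N : ℤ, ∃ I : ℕ, ∀ i : ℕ, I ≤ i → ∀ a b : ℤ, a ≤ b →
    (∀ j : ℤ, a ≤ j → j ≤ b → j ∈ Per A (u i) x) →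
    (a - 1) ∉ Per A (u i) x → (b + 1) ∉ Per A (u i) x → N ≤ b - a + 1

/-- `T**`: the set of Toeplitz subshifts having growing blocks with respect to the natural
factorization of their scale, inside `K(𝔫^ℤ)`. -/
def ToeplitzGrowingBlocks (A : Type) [MetricSpace A] : Set (NonemptyCompacts (ℤ → A)) :=
  {K | ∃ x : ℤ → A, IsToeplitzSeq A x ∧ (K : Set (ℤ → A)) = orbitClosure A x ∧
    HasGrowingBlocks A x (natFactorization A x)}

namespace ToeplitzConj

variable {A : Type}

/-- The windows of radius `N` of `y` around `a` and of `z` around `b` carry the same word. -/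
def Agree (N : ℕ) (y : ℤ → A) (a : ℤ) (z : ℤ → A) (b : ℤ) : Prop :=
  ∀ i : ℤ, -N ≤ i → i ≤ N → y (a + i) = z (b + i)

/-- Positions modulo `n` can be read off from windows of bounded size. -/
def Recognizes (K : Set (ℤ → A)) (n : ℕ) : Prop :=
  ∃ N : ℕ, ∀ y ∈ K, ∀ a b : ℤ, Agree N y a y b → (n : ℤ) ∣ a - b

/-- The counterpart of `rdot` for a subshift, defined through recognizable moduli. -/
noncomputable def level (K : Set (ℤ → A)) (t : ℕ) : ℕ :=
  ∏ i ∈ Finset.range (t + 1),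
    (Nat.nth Nat.Prime i) ^ sSup {j : ℕ | j ≤ t + 1 ∧ Recognizes K (Nat.nth Nat.Prime i ^ j)}

/-- The `i`-th and the `j`-th block of length `u` of `y` coincide. -/
def BlockEq (u : ℕ) (y : ℤ → A) (i j : ℤ) : Prop :=
  ∀ l : ℤ, 0 ≤ l → l < u → y (i * u + l) = y (j * u + l)

/-- `[a, b]` is a filled `u`-block of `y`. -/
def FilledBlock (u : ℕ) (y : ℤ → A) (a b : ℤ) : Prop :=
  a ≤ b ∧ (∀ j : ℤ, a ≤ j → j ≤ b → j ∈ Per A u y) ∧ a - 1 ∉ Per A u y ∧ b + 1 ∉ Per A u y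

/-- The origin is the midpoint of a filled `u`-block of `y`. -/
def Centered (u : ℕ) (y : ℤ → A) : Prop :=
  ∃ a b : ℤ, FilledBlock u y a b ∧ (a + b = 0 ∨ a + b = 1)

/-- The symbols of `z` are determined by the windows of `y` of radius `r`. -/
def Determines (r : ℕ) (y z : ℤ → A) : Prop :=
  ∀ m n : ℤ, Agree r y m y n → z m = z n

/-- All sequences whose windows occur in `y`. -/
def hull (y : ℤ → A) : Set (ℤ → A) := {z | ∀ N : ℕ, ∃ m : ℤ, Agree N z 0 y m}

theorem Agree.mono {N M : ℕ} (h : N ≤ M) {y z : ℤ → A} {a b : ℤ} (H : Agree M y a z b) :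
    Agree N y a z b := fun i h1 h2 => H i (by omega) (by omega)

theorem Agree.symm {N : ℕ} {y z : ℤ → A} {a b : ℤ} (H : Agree N y a z b) :
    Agree N z b y a := fun i h1 h2 => (H i h1 h2).symm

theorem Agree.apply {N : ℕ} {y z : ℤ → A} {m : ℤ} (H : Agree N y 0 z m) {i : ℤ}
    (h1 : -N ≤ i) (h2 : i ≤ N) : y i = z (i + m) := by
  have := H i h1 h2
  rwa [zero_add, add_comm] at this

theorem translate_mem_hull {x y : ℤ → A} (hy : y ∈ hull x) (m : ℤ) :
    (fun i => y (i + m)) ∈ hull x := by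
  intro N
  obtain ⟨k, hk⟩ := hy (N + m.natAbs)
  refine ⟨k + m, fun i h1 h2 => ?_⟩
  have := hk (i + m) (by omega) (by omega)
  simp only [zero_add] at this ⊢
  rw [this]; congr 1; ring

theorem self_mem_hull (x : ℤ → A) : x ∈ hull x := fun _ => ⟨0, fun _ _ _ => rfl⟩

theorem hull_subset {x y : ℤ → A} (hy : y ∈ hull x) : hull y ⊆ hull x := by
  intro z hz N
  obtain ⟨m, hm⟩ := hz N
  obtain ⟨k, hk⟩ := hy (N + m.natAbs)
  refine ⟨m + k, fun i h1 h2 => ?_⟩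
  rw [hm i h1 h2, hk.apply (by omega) (by omega)]
  congr 1; ring

theorem mem_per_add {p : ℕ} {x : ℤ → A} {i : ℤ} (h : i ∈ Per A p x) (k : ℤ) :
    i + p * k ∈ Per A p x := by
  intro l
  have h1 := h (k + l)
  have h2 := h k
  rw [h2, ← h1]; congr 1; ring

theorem mem_per_of_dvd {p q : ℕ} (hpq : p ∣ q) {x : ℤ → A} {i : ℤ} (h : i ∈ Per A p x) :
    i ∈ Per A q x := by
  obtain ⟨c, rfl⟩ := hpq
  intro k
  have := h (c * k)
  rw [← this]; push_cast; congr 1; ring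

section Toeplitz

variable {x : ℤ → A}

theorem exists_common_period (hx : IsToeplitzSeq A x) (u : ℕ) (hu : 1 ≤ u) (s : Finset ℤ) :
    ∃ M : ℕ, 1 ≤ M ∧ u ∣ M ∧ ∀ i ∈ s, i ∈ Per A M x := by
  induction s using Finset.induction_on with
  | empty => exact ⟨u, hu, dvd_rfl, by simp⟩
  | insert a s _ ih =>
    obtain ⟨M, hM, huM, h⟩ := ih
    obtain ⟨j, hj, hj'⟩ := hx.2 a
    refine ⟨M * j, Nat.mul_pos hM hj, huM.mul_right j, fun i hi => ?_⟩
    rcases Finset.mem_insert.1 hi with rfl | hi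
    · exact mem_per_of_dvd (dvd_mul_left j M) fun k => by rw [mul_comm]; exact hj' k
    · exact mem_per_of_dvd (dvd_mul_right M j) (h i hi)

theorem exists_agree_period (hx : IsToeplitzSeq A x) (u : ℕ) (hu : 1 ≤ u) (N : ℕ) :
    ∃ M : ℕ, 1 ≤ M ∧ u ∣ M ∧ ∀ k : ℤ, Agree N x (M * k) x 0 := by
  obtain ⟨M, hM, huM, h⟩ := exists_common_period hx u hu (Finset.Icc (-N : ℤ) N)
  refine ⟨M, hM, huM, fun k i h1 h2 => ?_⟩
  have := h i (Finset.mem_Icc.2 ⟨h1, h2⟩) k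
  rw [zero_add, ← this]; congr 1; ring

theorem mem_hull_symm (hx : IsToeplitzSeq A x) {y : ℤ → A} (hy : y ∈ hull x) : x ∈ hull y := by
  intro N
  obtain ⟨M, hM, -, h⟩ := exists_agree_period hx 1 le_rfl N
  obtain ⟨m, hm⟩ := hy (N + M)
  have hM' : (0 : ℤ) < M := by exact_mod_cast hM
  have h0 := Int.emod_add_mul_ediv m M
  have h1 := Int.emod_nonneg m hM'.ne'
  have h2 := Int.emod_lt_of_pos m hM'
  refine ⟨-(m % M), fun i h3 h4 => ?_⟩
  rw [hm.apply (by omega) (by omega), ← h (m / M) i h3 h4]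
  congr 1; linarith

theorem hull_eq (hx : IsToeplitzSeq A x) {y : ℤ → A} (hy : y ∈ hull x) : hull y = hull x :=
  (hull_subset hy).antisymm (hull_subset (mem_hull_symm hx hy))

/-- An essential period is recognizable. -/
theorem recognizes_of_essential (hx : IsToeplitzSeq A x) {e : ℕ} (he : IsEssentialPeriod A x e) :
    Recognizes {x} e := by
  obtain ⟨he1, -, hmin⟩ := he
  by_contra hcon
  simp only [Recognizes, Set.mem_singleton_iff, forall_eq, not_exists, not_forall] at hcon
  have he0 : (0 : ℤ) < e := by exact_mod_cast he1
  choose a b hab hnd using hcon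
  -- pigeonhole on the residues
  obtain ⟨d, hd⟩ : ∃ d : ℤ, ∃ᶠ N in atTop, (b N - a N) % e = d := by
    by_contra! H
    have H' : ∀ d ∈ Finset.Ico (0 : ℤ) e, ∀ᶠ N in atTop, (b N - a N) % e ≠ d := fun d _ => by
      simpa [Filter.Frequently] using H d
    obtain ⟨N, hN⟩ := ((Filter.eventually_all_finset _).2 H').exists
    exact hN _ (Finset.mem_Ico.2 ⟨Int.emod_nonneg _ he0.ne', Int.emod_lt_of_pos _ he0⟩) rfl
  have key : ∀ i ∈ Per A e x, ∀ k : ℤ, x (i + d + e * k) = x i := by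
    intro i hi k
    obtain ⟨M, hM, heM, hj⟩ := exists_common_period hx e he1 {i + d + e * k}
    have hj := hj _ (Finset.mem_singleton_self _)
    obtain ⟨N, hN, hNd⟩ := (Filter.frequently_atTop.1 hd) M
    set j := i + d + e * k with hjdef
    have hM' : (0 : ℤ) < M := by exact_mod_cast hM
    set r := (j - b N) % M with hr
    have h0 := Int.emod_add_mul_ediv (j - b N) M
    have h1 := Int.emod_nonneg (j - b N) hM'.ne'
    have h2 := Int.emod_lt_of_pos (j - b N) hM'
    have hag := hab N r (by omega) (by omega)
    have e1 : x (b N + r) = x j := by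
      rw [← hj (-((j - b N) / M))]; congr 1; rw [hr]; linarith
    obtain ⟨c, hc⟩ := heM
    have h3 := Int.emod_add_mul_ediv (b N - a N) e
    have e2 : x (a N + r) = x i := by
      rw [← hi (k - c * ((j - b N) / M) - (b N - a N) / e)]
      congr 1
      have : (M : ℤ) = e * c := by exact_mod_cast hc
      rw [this] at h0 
      rw [hr, this]
      linear_combination h0 + h3 - hNd + hjdef
    rw [← e1, ← hag, e2]
  have key2 : ∀ m : ℕ, ∀ i ∈ Per A e x, ∀ k : ℤ, x (i + d * m + e * k) = x i := by
    intro m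
    induction m with
    | zero => intro i hi k; simpa using hi k
    | succ m ih =>
      intro i hi k
      have hi' : i + d ∈ Per A e x := fun k => by
        have := key i hi 0
        rw [mul_zero, add_zero] at this
        rw [key i hi k, this]
      have h1 := ih _ hi' k
      have h2 := key i hi 0
      rw [mul_zero, add_zero] at h2
      rw [← h2, ← h1]; congr 1; push_cast; ring
  obtain ⟨N, hN⟩ := hd.exists
  have hd0 : 0 ≤ d := hN ▸ Int.emod_nonneg _ he0.ne'
  have hde : d < e := hN ▸ Int.emod_lt_of_pos _ he0
  have hdne : d ≠ 0 := by
    rintro rfl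
    exact hnd N ((Int.dvd_of_emod_eq_zero hN).neg_right.trans (by simp))
  obtain ⟨d', rfl⟩ := Int.eq_ofNat_of_zero_le hd0
  have hd' : 0 < d' := by omega
  refine hmin (Nat.gcd d' e) (Nat.gcd_pos_of_pos_left _ hd')
    (lt_of_le_of_lt (Nat.gcd_le_left _ hd') (by exact_mod_cast hde)) ?_
  ext i
  refine ⟨fun hi k => ?_, mem_per_of_dvd (Nat.gcd_dvd_right _ _)⟩
  have hb := Nat.gcd_eq_gcd_ab d' e
  set α := Nat.gcdA d' e * k
  have hα := Int.emod_add_mul_ediv α e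
  have hα0 := Int.emod_nonneg α he0.ne'
  have := key2 (α % e).toNat i hi (Nat.gcdB d' e * k + d' * (α / e))
  rw [Int.toNat_of_nonneg hα0] at this
  rw [← this, hb]
  congr 1
  linear_combination - d' * hα

end Toeplitz

theorem prime_nth (i : ℕ) : (Nat.nth Nat.Prime i).Prime := Nat.prime_nth_prime i

theorem Recognizes.of_dvd {K : Set (ℤ → A)} {m n : ℕ} (hmn : m ∣ n) (h : Recognizes K n) :
    Recognizes K m := by
  obtain ⟨N, hN⟩ := h
  exact ⟨N, fun y hy a b hab => (Int.natCast_dvd_natCast.2 hmn).trans (hN y hy a b hab)⟩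

theorem Recognizes.mono {K L : Set (ℤ → A)} {n : ℕ} (hKL : K ⊆ L) (h : Recognizes L n) :
    Recognizes K n := by
  obtain ⟨N, hN⟩ := h
  exact ⟨N, fun y hy => hN y (hKL hy)⟩

theorem recognizes_one (K : Set (ℤ → A)) : Recognizes K 1 := ⟨0, by simp⟩

theorem Recognizes.mul {K : Set (ℤ → A)} {m n : ℕ} (hmn : Nat.Coprime m n)
    (hm : Recognizes K m) (hn : Recognizes K n) : Recognizes K (m * n) := by
  obtain ⟨M, hM⟩ := hm
  obtain ⟨N, hN⟩ := hn
  refine ⟨max M N, fun y hy a b hab => ?_⟩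
  push_cast
  exact (Nat.isCoprime_iff_coprime.2 hmn).mul_dvd (hM y hy a b (hab.mono (le_max_left _ _)))
    (hN y hy a b (hab.mono (le_max_right _ _)))

theorem Recognizes.hull_of_singleton {x : ℤ → A} {n : ℕ} (h : Recognizes {x} n) :
    Recognizes (hull x) n := by
  obtain ⟨N, hN⟩ := h
  refine ⟨N, fun y hy a b hab => ?_⟩
  obtain ⟨m, hm⟩ := hy (N + a.natAbs + b.natAbs)
  have := hN x rfl (a + m) (b + m) fun i h1 h2 => by
    have e1 := hm.apply (i := a + i) (by omega) (by omega)
    have e2 := hm.apply (i := b + i) (by omega) (by omega)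
    have e3 := hab i h1 h2
    rw [e1, e2] at e3
    convert e3 using 2 <;> ring
  simpa using this

theorem bddAbove_exponents (K : Set (ℤ → A)) (i t : ℕ) :
    BddAbove {j : ℕ | j ≤ t + 1 ∧ Recognizes K (Nat.nth Nat.Prime i ^ j)} :=
  ⟨t + 1, fun _ h => h.1⟩

theorem sSup_exponents_mem (K : Set (ℤ → A)) (i t : ℕ) :
    Recognizes K (Nat.nth Nat.Prime i ^
      sSup {j : ℕ | j ≤ t + 1 ∧ Recognizes K (Nat.nth Nat.Prime i ^ j)}) :=
  (Nat.sSup_mem (s := {j : ℕ | j ≤ t + 1 ∧ Recognizes K (Nat.nth Nat.Prime i ^ j)})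
    ⟨0, Nat.zero_le _, by simpa using recognizes_one K⟩ (bddAbove_exponents K i t)).2

theorem recognizes_level (K : Set (ℤ → A)) (t : ℕ) : Recognizes K (level K t) := by
  unfold level
  generalize Finset.range (t + 1) = s
  induction s using Finset.induction_on with
  | empty => simpa using recognizes_one K
  | insert a s ha ih =>
    rw [Finset.prod_insert ha]
    refine Recognizes.mul (Nat.Coprime.prod_right fun i hi => ?_) (sSup_exponents_mem K a t) ih
    refine Nat.coprime_pow_primes _ _ (prime_nth a) (prime_nth i) fun h => ?_
    have := (Nat.nth_strictMono Nat.infinite_setOfPred_prime).injective h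
    exact ha (this ▸ hi)

theorem level_pos (K : Set (ℤ → A)) (t : ℕ) : 0 < level K t :=
  Finset.prod_pos fun i _ => pow_pos (prime_nth i).pos _

theorem level_dvd_succ (K : Set (ℤ → A)) (t : ℕ) : level K t ∣ level K (t + 1) := by
  refine (Finset.prod_dvd_prod_of_dvd _ _ fun i _ => pow_dvd_pow _ ?_).trans
    (Finset.prod_dvd_prod_of_subset _ _ _ (Finset.range_subset_range.2 (Nat.le_succ _)))
  exact csSup_le_csSup (bddAbove_exponents K i _) ⟨0, Nat.zero_le _,
    by simpa using recognizes_one K⟩ fun j hj => ⟨hj.1.trans (Nat.le_succ _), hj.2⟩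

theorem level_dvd (K : Set (ℤ → A)) {s t : ℕ} (h : s ≤ t) : level K s ∣ level K t := by
  induction t, h using Nat.le_induction with
  | base => exact dvd_rfl
  | succ t _ ih => exact ih.trans (level_dvd_succ K t)

theorem dvd_level {K : Set (ℤ → A)} {n t : ℕ} (hn : 1 ≤ n) (hnt : n ≤ t) (h : Recognizes K n) :
    n ∣ level K t := by
  rw [Nat.dvd_iff_prime_pow_dvd_dvd]
  intro p k hp hk
  rcases Nat.eq_zero_or_pos k with rfl | hk0
  · simp
  have hpn : p ≤ n := Nat.le_of_dvd hn ((dvd_pow_self p hk0.ne').trans hk)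
  have hkn : k ≤ n := (Nat.lt_pow_self hp.one_lt).le.trans (Nat.le_of_dvd hn hk)
  have hc : Nat.count Nat.Prime p ≤ p := Nat.count_le _
  have hnth : Nat.nth Nat.Prime (Nat.count Nat.Prime p) = p := Nat.nth_count hp
  have : p ^ k ∣ Nat.nth Nat.Prime (Nat.count Nat.Prime p) ^
      sSup {j : ℕ | j ≤ t + 1 ∧ Recognizes K (Nat.nth Nat.Prime (Nat.count Nat.Prime p) ^ j)} := by
    rw [hnth]
    refine pow_dvd_pow _ (le_csSup ⟨t + 1, fun _ h => h.1⟩ ⟨by omega, h.of_dvd hk⟩)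
  exact this.trans (Finset.dvd_prod_of_mem (fun i => Nat.nth Nat.Prime i ^
    sSup {j : ℕ | j ≤ t + 1 ∧ Recognizes K (Nat.nth Nat.Prime i ^ j)})
    (Finset.mem_range.2 (by omega)))

/-- Every nonempty periodic part is the one of an essential period. -/
theorem exists_essential {x : ℤ → A} {i : ℤ} {j : ℕ} (hj : 1 ≤ j) (hi : i ∈ Per A j x) :
    ∃ e : ℕ, IsEssentialPeriod A x e ∧ i ∈ Per A e x := by
  classical
  have hex : ∃ e : ℕ, 1 ≤ e ∧ Per A e x = Per A j x := ⟨j, hj, rfl⟩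
  obtain ⟨h1, h2⟩ := Nat.find_spec hex
  have hi' : i ∈ Per A (Nat.find hex) x := h2.symm ▸ hi
  refine ⟨Nat.find hex, ⟨h1, ⟨i, hi'⟩, fun q hq hlt heq => ?_⟩, hi'⟩
  exact Nat.find_min hex hlt ⟨hq, heq ▸ h2⟩

section Toeplitz

variable {x : ℤ → A}

theorem exists_essential_of_toeplitz (hx : IsToeplitzSeq A x) (i : ℤ) :
    ∃ e : ℕ, IsEssentialPeriod A x e ∧ i ∈ Per A e x := by
  obtain ⟨j, hj, h⟩ := hx.2 i
  exact exists_essential hj fun k => by rw [mul_comm]; exact h k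

theorem exists_essential_dvd (hx : IsToeplitzSeq A x)
    {p k : ℕ} (hp : p.Prime) (h : Recognizes {x} (p ^ k)) :
    ∃ e : ℕ, IsEssentialPeriod A x e ∧ p ^ k ∣ e := by
  rcases Nat.eq_zero_or_pos k with rfl | hk
  · obtain ⟨e, he, -⟩ := exists_essential_of_toeplitz hx 0
    exact ⟨e, he, by simp⟩
  by_contra! hcon
  have key : ∀ s : Finset ℤ, ∃ M : ℕ, 1 ≤ M ∧ ¬ p ^ k ∣ M ∧ ∀ i ∈ s, i ∈ Per A M x := by
    intro s
    induction s using Finset.induction_on with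
    | empty => exact ⟨1, le_rfl, by simp [hp.ne_one, hk.ne'], by simp⟩
    | insert a s _ ih =>
      obtain ⟨M, hM, hpM, hs⟩ := ih
      obtain ⟨e, he, hae⟩ := exists_essential_of_toeplitz hx a
      have he0 : e ≠ 0 := by have := he.1; omega
      refine ⟨Nat.lcm M e, Nat.pos_of_ne_zero (Nat.lcm_ne_zero (by omega) he0), ?_, fun i hi => ?_⟩
      · have hpe := hcon e he
        rw [hp.pow_dvd_iff_le_factorization (by omega)] at hpM hpe
        rw [hp.pow_dvd_iff_le_factorization (Nat.lcm_ne_zero (by omega) he0),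
          Nat.factorization_lcm (by omega) he0, Finsupp.sup_apply]
        simp only [le_sup_iff, not_or]
        exact ⟨hpM, hpe⟩
      · rcases Finset.mem_insert.1 hi with rfl | hi
        · exact mem_per_of_dvd (Nat.dvd_lcm_right _ _) hae
        · exact mem_per_of_dvd (Nat.dvd_lcm_left _ _) (hs i hi)
  obtain ⟨N, hN⟩ := h
  obtain ⟨M, -, hpM, hM⟩ := key (Finset.Icc (-N : ℤ) N)
  refine hpM ?_
  have := hN x rfl M 0 fun i h1 h2 => by
    have := hM i (Finset.mem_Icc.2 ⟨h1, h2⟩) 1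
    rw [zero_add, ← this]; congr 1; ring
  rw [sub_zero] at this
  exact_mod_cast this

theorem rdot_eq_level (hx : IsToeplitzSeq A x) (t : ℕ) : rdot A x t = level (hull x) t := by
  unfold rdot level
  refine Finset.prod_congr rfl fun i _ => ?_
  congr 2
  ext j
  refine and_congr_right fun _ => ⟨?_, fun h => ?_⟩
  · rintro ⟨e, he, hd⟩
    exact (recognizes_of_essential hx he).hull_of_singleton.of_dvd hd
  · exact exists_essential_dvd hx (prime_nth i)
      (h.mono (Set.singleton_subset_iff.2 (self_mem_hull x)))

theorem eventually_mem_per_level (hx : IsToeplitzSeq A x) (i : ℤ) :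
    ∃ T : ℕ, ∀ t, T ≤ t → i ∈ Per A (level (hull x) t) x := by
  obtain ⟨e, he, hi⟩ := exists_essential_of_toeplitz hx i
  exact ⟨e, fun t ht =>
    mem_per_of_dvd (dvd_level he.1 ht (recognizes_of_essential hx he).hull_of_singleton) hi⟩

theorem level_unbounded (hx : IsToeplitzSeq A x) (B : ℕ) : ∃ t, B < level (hull x) t := by
  by_contra! hB
  obtain ⟨T, hT⟩ : ∃ T, ∀ t, T ≤ t → level (hull x) t = level (hull x) T := by
    have hmono : Monotone (level (hull x)) := fun s t h =>
      Nat.le_of_dvd (level_pos _ _) (level_dvd _ h)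
    have hfin : (Set.range (level (hull x))).Finite :=
      (Set.finite_Iic B).subset (by rintro _ ⟨t, rfl⟩; exact hB t)
    obtain ⟨_, ⟨T, rfl⟩, hmax⟩ := Set.exists_max_image _ id hfin (Set.range_nonempty _)
    exact ⟨T, fun t ht => (hmax _ ⟨t, rfl⟩).antisymm (hmono ht)⟩
  refine hx.1 ⟨level (hull x) T, level_pos _ _, fun i => ?_⟩
  obtain ⟨T', hT'⟩ := eventually_mem_per_level hx i
  have := hT' (max T T') (le_max_right _ _) 1
  rwa [hT _ (le_max_left _ _), mul_one] at this

theorem filledBlock_growing (hx : IsToeplitzSeq A x)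
    (hg : HasGrowingBlocks A x (natFactorization A x)) (N : ℤ) :
    ∃ T : ℕ, ∀ t, T ≤ t → ∀ a b : ℤ, FilledBlock (level (hull x) t) x a b → N ≤ b - a + 1 := by
  obtain ⟨I, hI⟩ := hg N
  set P : ℕ → Prop := fun m => m ≠ 1 ∧ ∃ t : ℕ, rdot A x t = m with hP
  have hinf : {m | P m}.Infinite := by
    refine Set.infinite_of_forall_exists_gt fun B => ?_
    obtain ⟨t, ht⟩ := level_unbounded hx (B + 1)
    exact ⟨_, ⟨by omega, t, rdot_eq_level hx t⟩, by omega⟩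
  obtain ⟨T, hT⟩ := level_unbounded hx (Nat.nth P I + 1)
  refine ⟨T, fun t ht a b hab => ?_⟩
  have hle := Nat.le_of_dvd (level_pos _ _) (level_dvd (hull x) ht)
  obtain ⟨i, -, hi⟩ := Nat.exists_lt_card_nth_eq (p := P) (x := level (hull x) t)
    ⟨by omega, t, rdot_eq_level hx t⟩
  have hIi : I ≤ i := by
    have : Nat.nth P I < Nat.nth P i := by omega
    exact ((Nat.nth_strictMono hinf).lt_iff_lt.1 this).le
  have hnat : natFactorization A x i = level (hull x) t := hi
  refine hI i hIi a b hab.1 ?_ ?_ ?_ <;> rw [hnat]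
  exacts [hab.2.1, hab.2.2.1, hab.2.2.2]

/-- Up to a shift, the periodic parts of all elements of the subshift agree. -/
theorem per_eq_translate (hx : IsToeplitzSeq A x)
    {u : ℕ} (hu : 1 ≤ u) (hrec : Recognizes (hull x) u) {y : ℤ → A}
    (hy : y ∈ hull x) : ∃ m : ℤ, ∀ j : ℤ, j ∈ Per A u y ↔ j + m ∈ Per A u x := by
  obtain ⟨N₀, hN₀⟩ := hrec
  obtain ⟨m, hm⟩ := hy N₀
  have hmod : ∀ N, N₀ ≤ N → ∀ m', Agree N y 0 x m' → (u : ℤ) ∣ m' - m := fun N hN m' h =>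
    hN₀ x (self_mem_hull x) _ _ fun i h1 h2 =>
      ((h.mono hN) i h1 h2).symm.trans (hm i h1 h2)
  refine ⟨m, fun j => ⟨fun hj k => ?_, fun hj k => ?_⟩⟩
  · obtain ⟨M, hM, huM, hper⟩ := exists_common_period hx u hu {j + m + u * k, j + m}
    have h1 := hper (j + m + u * k) (by simp)
    have h2 := hper (j + m) (by simp)
    obtain ⟨m', hm'⟩ := hy (N₀ + M)
    obtain ⟨c, hc⟩ := hmod _ (by omega) m' hm'
    obtain ⟨d, rfl⟩ := huM
    have hM' : (0 : ℤ) < ((u * d : ℕ) : ℤ) := by exact_mod_cast hM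
    have find : ∀ q : ℤ, j + m + u * q ∈ Per A (u * d) x → x (j + m + u * q) = y j := by
      intro q hq
      set p := j + m + u * q - m' with hp
      have e0 := Int.emod_add_mul_ediv p (u * d : ℕ)
      have e1 := Int.emod_nonneg p hM'.ne'
      have e2 := Int.emod_lt_of_pos p hM'
      have e3 := hm'.apply (i := p % (u * d : ℕ)) (by omega) (by omega)
      have e4 := hq (-(p / (u * d : ℕ)))
      have e5 := hj (q - c - d * (p / (u * d : ℕ)))
      rw [← e4, ← e5]
      have : j + m + u * q + (u * d : ℕ) * -(p / (u * d : ℕ)) = p % (u * d : ℕ) + m' := by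
        linear_combination -e0 + hp
      rw [this, ← e3]
      congr 1
      push_cast at e0 ⊢
      linear_combination e0 - hc + hp
    rw [find k h1]
    have := find 0 (by simpa using h2)
    rw [mul_zero, add_zero] at this
    exact this.symm
  · obtain ⟨m', hm'⟩ := hy (N₀ + j.natAbs + (j + u * k).natAbs)
    obtain ⟨c, hc⟩ := hmod _ (by omega) m' hm'
    rw [hm'.apply (by omega) (by omega), hm'.apply (i := j) (by omega) (by omega)]
    have e1 := hj (k + c)
    have e2 := hj c
    rw [← e2] at e1
    convert e1 using 2
    · linear_combination hc
    · linear_combination hc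

theorem filledBlock_growing_hull (hx : IsToeplitzSeq A x)
    (hg : HasGrowingBlocks A x (natFactorization A x)) (N : ℤ) :
    ∃ T : ℕ, ∀ t, T ≤ t → ∀ y ∈ hull x, ∀ a b : ℤ,
      FilledBlock (level (hull x) t) y a b → N ≤ b - a + 1 := by
  obtain ⟨T, hT⟩ := filledBlock_growing hx hg N
  refine ⟨T, fun t ht y hy a b hab => ?_⟩
  obtain ⟨m, hm⟩ := per_eq_translate hx (level_pos _ t) (recognizes_level _ t) hy
  have := hT t ht (a + m) (b + m) ⟨by linarith [hab.1], fun j h1 h2 => ?_, ?_, ?_⟩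
  · linarith
  · have := (hm (j - m)).1 (hab.2.1 _ (by linarith) (by linarith))
    rwa [sub_add_cancel] at this
  · have := mt (hm (a - 1)).2 hab.2.2.1
    rwa [show a - 1 + m = a + m - 1 by ring] at this
  · have := mt (hm (b + 1)).2 hab.2.2.2
    rwa [show b + 1 + m = b + m + 1 by ring] at this

end Toeplitz

theorem exists_filledBlock {u : ℕ} {y : ℤ → A} {c a₀ b₀ : ℤ} (hc : c ∈ Per A u y)
    (ha : a₀ ∉ Per A u y) (hb : b₀ ∉ Per A u y) (hac : a₀ ≤ c) (hcb : c ≤ b₀) :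
    ∃ a b : ℤ, a₀ < a ∧ a ≤ c ∧ c ≤ b ∧ b < b₀ ∧ FilledBlock u y a b := by
  classical
  obtain ⟨a, ⟨ha1, ha2⟩, hamax⟩ := Int.exists_greatest_of_bdd
    (P := fun z => z ≤ c ∧ z ∉ Per A u y) ⟨c, fun z hz => hz.1⟩ ⟨a₀, hac, ha⟩
  obtain ⟨b, ⟨hb1, hb2⟩, hbmin⟩ := Int.exists_least_of_bdd
    (P := fun z => c ≤ z ∧ z ∉ Per A u y) ⟨c, fun z hz => hz.1⟩ ⟨b₀, hcb, hb⟩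
  have hac' : a ≠ c := by rintro rfl; exact ha2 hc
  have hbc' : b ≠ c := by rintro rfl; exact hb2 hc
  have hh1 := hamax a₀ ⟨hac, ha⟩
  have hh2 := hbmin b₀ ⟨hcb, hb⟩
  refine ⟨a + 1, b - 1, by omega, by omega, by omega, by omega, by omega, fun j h1 h2 => ?_,
    by simpa using ha2, by simpa using hb2⟩
  by_contra hj
  rcases le_total j c with h | h
  · have := hamax j ⟨h, hj⟩; omega
  · have := hbmin j ⟨h, hj⟩; omega

theorem mem_per_translate {u : ℕ} {y : ℤ → A} {m j : ℤ} :
    j ∈ Per A u (fun i => y (i + m)) ↔ j + m ∈ Per A u y := by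
  refine forall_congr' fun k => ?_
  dsimp only
  rw [show j + u * k + m = j + m + u * k by ring]

theorem FilledBlock.translate {u : ℕ} {y : ℤ → A} {a b : ℤ} (h : FilledBlock u y a b) (m : ℤ) :
    FilledBlock u (fun i => y (i + m)) (a - m) (b - m) := by
  refine ⟨by linarith [h.1], fun j h1 h2 => mem_per_translate.2
    (h.2.1 _ (by linarith) (by linarith)), fun H => h.2.2.1 ?_, fun H => h.2.2.2 ?_⟩
  · have := mem_per_translate.1 H
    rwa [show a - m - 1 + m = a - 1 by ring] at this
  · have := mem_per_translate.1 H
    rwa [show b - m + 1 + m = b + 1 by ring] at this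

theorem FilledBlock.centered {u : ℕ} {y : ℤ → A} {a b : ℤ} (h : FilledBlock u y a b) :
    Centered u (fun i => y (i + (a + b) / 2)) :=
  ⟨_, _, h.translate ((a + b) / 2), by omega⟩

theorem exists_centered {x : ℤ → A} (hx : IsToeplitzSeq A x) :
    ∃ T : ℕ, ∀ t, T ≤ t → ∃ y ∈ hull x, Centered (level (hull x) t) y := by
  obtain ⟨T, hT⟩ := eventually_mem_per_level hx 0
  refine ⟨T, fun t ht => ?_⟩
  set u := level (hull x) t with hu
  have hu0 : (0 : ℤ) < u := by exact_mod_cast level_pos (hull x) t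
  obtain ⟨i, hi⟩ : ∃ i : ℤ, i ∉ Per A u x := by
    by_contra! H
    exact hx.1 ⟨u, level_pos _ _, fun i => by simpa using H i 1⟩
  have hi' : ∀ k : ℤ, i + u * k ∉ Per A u x := fun k H => hi (by
    have := mem_per_add H (-k)
    rwa [show i + u * k + u * -k = i by ring] at this)
  have hle : |i| ≤ u * |i| := le_mul_of_one_le_left (abs_nonneg i) (by omega)
  obtain ⟨a, b, -, -, -, -, hab⟩ := exists_filledBlock (hT t ht) (hi' (-|i|)) (hi' |i|)
    (by linarith [le_abs_self i]) (by linarith [neg_abs_le i])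
  exact ⟨_, translate_mem_hull (self_mem_hull x) _, hab.centered⟩

theorem determines_of_blockEq {u : ℕ} (hu : 1 ≤ u) {K : Set (ℤ → A)} (hrec : Recognizes K u)
    {y z : ℤ → A} (hy : y ∈ K) (h : ∀ i j, BlockEq u y i j → BlockEq u z i j) :
    ∃ R : ℕ, ∀ r, R ≤ r → Determines r y z := by
  obtain ⟨N, hN⟩ := hrec
  refine ⟨N + u, fun r hr m n hmn => ?_⟩
  obtain ⟨c, hc⟩ := hN y hy m n (hmn.mono (by omega))
  have hu0 : (0 : ℤ) < u := by exact_mod_cast hu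
  have e0 := Int.emod_add_mul_ediv m u
  have e1 := Int.emod_nonneg m hu0.ne'
  have e2 := Int.emod_lt_of_pos m hu0
  have := h (m / u) (m / u - c) (fun l h1 h2 => ?_) (m % u) e1 e2
  · convert this using 2
    · linear_combination -e0
    · linear_combination -e0 - hc
  · have := hmn (l - m % u) (by omega) (by omega)
    convert this using 2
    · linear_combination e0
    · linear_combination e0 + hc

theorem Determines.mem_per {r u : ℕ} {y z : ℤ → A} (h : Determines r y z) {j : ℤ}
    (hj : ∀ i : ℤ, j - r ≤ i → i ≤ j + r → i ∈ Per A u y) : j ∈ Per A u z := fun k =>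
  h _ _ fun i h1 h2 => by
    rw [← hj (j + i) (by omega) (by omega) k]; congr 1; ring

theorem Determines.blockEq {r u : ℕ} {y z : ℤ → A} (h : Determines r y z)
    (hper : ∀ i : ℤ, -r ≤ i → i ≤ r → i ∈ Per A u y) {i j : ℤ} (hij : BlockEq u y i j) :
    BlockEq u z i j := by
  have hper' : ∀ l k : ℤ, -r ≤ l → l ≤ r → y (k * u + l) = y l := fun l k h1 h2 => by
    rw [← hper l h1 h2 k]; congr 1; ring
  have hwide : ∀ l : ℤ, -r ≤ l → l < u + r → y (i * u + l) = y (j * u + l) := by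
    intro l h1 h2
    rcases lt_or_ge l 0 with h3 | h3
    · rw [hper' l i h1 (by omega), hper' l j h1 (by omega)]
    rcases lt_or_ge l u with h4 | h4
    · exact hij l h3 h4
    · have e1 := hper' (l - u) (i + 1) (by omega) (by omega)
      have e2 := hper' (l - u) (j + 1) (by omega) (by omega)
      rw [← e2] at e1
      convert e1 using 2 <;> ring
  intro l h1 h2
  refine h _ _ fun k h3 h4 => ?_
  have := hwide (l + k) (by omega) (by omega)
  convert this using 2 <;> ring

theorem Determines.translate {r s : ℕ} {y z : ℤ → A} (h : Determines r y z) {m : ℤ}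
    (h1 : -s ≤ m) (h2 : m ≤ s) : Determines (r + s) y (fun i => z (i + m)) := fun a b hab =>
  h _ _ fun i h3 h4 => by
    have := hab (m + i) (by push_cast; omega) (by push_cast; omega)
    convert this using 2 <;> ring

theorem Determines.translate_left {r s : ℕ} {y z : ℤ → A} (h : Determines r z y) {m : ℤ}
    (h1 : -s ≤ m) (h2 : m ≤ s) : Determines (r + s) (fun i => z (i + m)) y := fun a b hab =>
  h _ _ fun i h3 h4 => by
    have := hab (i - m) (by push_cast; omega) (by push_cast; omega)
    convert this using 2 <;> ring

/-- A centered sequence can be matched, up to a small shift, with a centered sequence having the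
same pattern of equal blocks, provided that the central filled block is long. -/
theorem exists_centered_blockEq {r u : ℕ} {y z : ℤ → A} (hyz : Determines r y z)
    (hzy : Determines r z y) (hy : Centered u y)
    (hlong : ∀ a b : ℤ, FilledBlock u y a b → 6 * r + 3 ≤ b - a + 1) :
    ∃ s : ℤ, Centered u (fun i => z (i + s)) ∧
      ∀ i j, BlockEq u (fun i => z (i + s)) i j ↔ BlockEq u y i j := by
  obtain ⟨a, b, hab, hsum⟩ := hy
  have hlen := hlong a b hab
  obtain ⟨-, hfill, hna, hnb⟩ := hab
  have hfill' : ∀ j : ℤ, a + r ≤ j → j ≤ b - r → j ∈ Per A u z := fun j h1 h2 =>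
    hyz.mem_per fun i h3 h4 => hfill i (by omega) (by omega)
  obtain ⟨a₀, ha₀, ha₀', hna₀⟩ : ∃ a₀ : ℤ, a - 1 - r ≤ a₀ ∧ a₀ ≤ a - 1 + r ∧ a₀ ∉ Per A u z := by
    by_contra! H
    exact hna (hzy.mem_per H)
  obtain ⟨b₀, hb₀, hb₀', hnb₀⟩ : ∃ b₀ : ℤ, b + 1 - r ≤ b₀ ∧ b₀ ≤ b + 1 + r ∧ b₀ ∉ Per A u z := by
    by_contra! H
    exact hnb (hzy.mem_per H)
  obtain ⟨a', b', h1, h2, h3, h4, hab'⟩ := exists_filledBlock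
    (hfill' 0 (by omega) (by omega)) hna₀ hnb₀ (by omega) (by omega)
  have h5 : a' ≤ a + r := by
    by_contra! H
    exact hab'.2.2.1 (hfill' _ (by omega) (by omega))
  have h6 : b - r ≤ b' := by
    by_contra! H
    exact hab'.2.2.2 (hfill' _ (by omega) (by omega))
  have hs1 : -(r : ℤ) ≤ (a' + b') / 2 := by omega
  have hs2 : (a' + b') / 2 ≤ r := by omega
  refine ⟨(a' + b') / 2, hab'.centered, fun i j => ⟨fun h => ?_, fun h => ?_⟩⟩
  · refine (hzy.translate_left hs1 hs2).blockEq (fun l h7 h8 => ?_) h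
    exact (hab'.translate _).2.1 l (by push_cast at h7 h8; omega) (by push_cast at h7 h8; omega)
  · refine (hyz.translate hs1 hs2).blockEq (fun l h7 h8 => ?_) h
    exact hfill l (by push_cast at h7 h8; omega) (by push_cast at h7 h8; omega)

theorem shiftMap_iterate (x : ℤ → A) (n : ℕ) : (shiftMap A)^[n] x = fun i => x (i + n) := by
  induction n with
  | zero => simp
  | succ n ih =>
    rw [Function.iterate_succ_apply', ih]
    funext i
    simp only [shiftMap]
    congr 1; push_cast; ring

theorem apply_translate {O O' : Set (ℤ → A)} (hO : ∀ z ∈ O, ∀ m : ℤ, (fun i => z (i + m)) ∈ O)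
    {e : O → O'} (he : ∀ x y : O, (y : ℤ → A) = shiftMap A x → (e y : ℤ → A) = shiftMap A (e x))
    (m : ℤ) : ∀ z w : O, ((w : ℤ → A) = fun i => (z : ℤ → A) (i + m)) →
      (e w : ℤ → A) = fun i => (e z : ℤ → A) (i + m) := by
  induction m using Int.induction_on with
  | zero =>
    intro z w h
    have : w = z := Subtype.ext (by simpa using h)
    simp [this]
  | succ k ih =>
    intro z w h
    have h1 := he ⟨_, hO z z.2 k⟩ w (by
      rw [h]; funext i; simp only [shiftMap]; ring_nf)
    rw [h1, ih z ⟨_, hO z z.2 k⟩ rfl]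
    funext i; simp only [shiftMap]; ring_nf
  | pred k ih =>
    intro z w h
    have h1 := he w ⟨_, hO z z.2 (-k)⟩ (by
      rw [h]; funext i; simp only [shiftMap]; ring_nf)
    rw [ih z ⟨_, hO z z.2 (-k)⟩ rfl] at h1
    funext i
    have h2 := congrFun h1 (i - 1)
    simp only [shiftMap, sub_add_cancel] at h2
    rw [← h2]; ring_nf

theorem exists_agree_subset [TopologicalSpace A] {U : Set (ℤ → A)} (hU : IsOpen U)
    {z : ℤ → A} (hz : z ∈ U) :
    ∃ N : ℕ, ∀ w, Agree N z 0 w 0 → w ∈ U := by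
  obtain ⟨I, V, hV, hsub⟩ := isOpen_pi_iff.1 hU z hz
  refine ⟨I.sup Int.natAbs, fun w hw => hsub fun i hi => ?_⟩
  have := Finset.le_sup (f := Int.natAbs) hi
  have := hw i (by omega) (by omega)
  rw [zero_add] at this
  exact this ▸ (hV i hi).2

theorem IsTopConj.symm_of_invariant [TopologicalSpace A] {O O' : Set (ℤ → A)}
    (hO : ∀ z ∈ O, shiftMap A z ∈ O) (h : IsTopConj A O O') : IsTopConj A O' O := by
  obtain ⟨e, he⟩ := h
  refine ⟨e.symm, fun z w hzw => ?_⟩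
  have h1 := he (e.symm z) ⟨_, hO _ (e.symm z).2⟩ rfl
  rw [e.apply_symm_apply, ← hzw] at h1
  rw [← Subtype.ext h1, e.symm_apply_apply]

section Topology

variable [TopologicalSpace A] [DiscreteTopology A]

theorem isClopen_apply_eq {X : Type*} [TopologicalSpace X] {f g : X → ℤ → A} (hf : Continuous f)
    (hg : Continuous g) (i j : ℤ) : IsClopen {p | f p i = g p j} :=
  (isClopen_discrete {q : A × A | q.1 = q.2}).preimage
    (((continuous_apply i).comp hf).prodMk ((continuous_apply j).comp hg))

theorem isClopen_agree {X : Type*} [TopologicalSpace X] {f g : X → ℤ → A} (hf : Continuous f)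
    (hg : Continuous g) (N : ℕ) (a b : ℤ) : IsClopen {p | Agree N (f p) a (g p) b} := by
  have : {p | Agree N (f p) a (g p) b} =
      ⋂ i ∈ Finset.Icc (-N : ℤ) N, {p | f p (a + i) = g p (b + i)} := by
    ext p; simp [Agree]
  rw [this]
  exact isClopen_biInter_finset fun i _ => isClopen_apply_eq hf hg _ _

theorem isClopen_blockEq (u : ℕ) (i j : ℤ) : IsClopen {y : ℤ → A | BlockEq u y i j} := by
  have : {y : ℤ → A | BlockEq u y i j} =
      ⋂ l ∈ Finset.Ico (0 : ℤ) u, {y | y (i * u + l) = y (j * u + l)} := by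
    ext p; simp [BlockEq]
  rw [this]
  exact isClopen_biInter_finset fun l _ => isClopen_apply_eq continuous_id continuous_id _ _

theorem orbitClosure_eq_hull {x : ℤ → A} (hx : IsToeplitzSeq A x) :
    orbitClosure A x = hull x := by
  ext z
  refine ⟨fun hz N => ?_, fun hz => mem_closure_iff.2 fun U hU hzU => ?_⟩
  · obtain ⟨w, hw, n, rfl⟩ := mem_closure_iff.1 hz {w | Agree N z 0 w 0}
      (isClopen_agree continuous_const continuous_id N 0 0).isOpen (fun _ _ _ => rfl)
    refine ⟨n, fun i h1 h2 => ?_⟩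
    rw [hw i h1 h2, shiftMap_iterate]
    ring_nf
  · obtain ⟨N, hN⟩ := exists_agree_subset hU hzU
    obtain ⟨m, hm⟩ := hz N
    obtain ⟨M, hM, -, hper⟩ := exists_common_period hx 1 le_rfl (Finset.Icc (m - N) (m + N))
    have hle : |m| ≤ M * |m| := le_mul_of_one_le_left (abs_nonneg m) (by exact_mod_cast hM)
    have h0 : 0 ≤ m + M * |m| := by linarith [neg_abs_le m]
    refine ⟨_, hN _ fun i h1 h2 => ?_, (m + M * |m|).toNat, rfl⟩
    rw [hm i h1 h2, shiftMap_iterate]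
    simp only [Int.toNat_of_nonneg h0]
    rw [← hper (m + i) (Finset.mem_Icc.2 ⟨by omega, by omega⟩) |m|]
    congr 1; ring

/-- Sequences that determine each other locally generate conjugate subshifts. -/
theorem isTopConj_of_determines {r : ℕ} {y z : ℤ → A} (hyz : Determines r y z)
    (hzy : Determines r z y) : IsTopConj A (hull y) (hull z) := by
  have loc : ∀ {y : ℤ → A} (w : hull y) (N : ℕ) (i : ℤ), ∃ m, Agree N (w : ℤ → A) i y m := by
    intro y w N i
    obtain ⟨m, hm⟩ := translate_mem_hull w.2 i N
    refine ⟨m, fun k h1 h2 => ?_⟩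
    rw [← hm k h1 h2]; ring_nf
  have main : ∀ {y z : ℤ → A}, Determines r y z → ∃ π : hull y → hull z, Continuous π ∧
      ∀ w : hull y, ∀ i m, Agree r (w : ℤ → A) i y m → (π w : ℤ → A) i = z m := by
    intro y z h
    choose p hp using fun w : hull y => loc w r
    have key : ∀ w : hull y, ∀ i m, Agree r (w : ℤ → A) i y m → z (p w i) = z m := fun w i m hm =>
      h _ _ fun k h1 h2 => (hp w i k h1 h2).symm.trans (hm k h1 h2)
    refine ⟨fun w => ⟨fun i => z (p w i), fun N => ?_⟩, ?_, key⟩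
    · obtain ⟨m, hm⟩ := w.2 (N + r)
      refine ⟨m, fun i h1 h2 => key _ _ _ fun k h3 h4 => ?_⟩
      have := hm (i + k) (by push_cast; omega) (by push_cast; omega)
      convert this using 2 <;> ring
    · refine Continuous.subtype_mk (continuous_pi fun i => IsLocallyConstant.continuous ?_) _
      refine (IsLocallyConstant.iff_exists_open _).2 fun w => ⟨{v | Agree r (v : ℤ → A) i w i},
        (isClopen_agree continuous_subtype_val continuous_const r i i).isOpen, fun _ _ _ => rfl,
        fun v hv => key v i _ fun k h1 h2 => (hv k h1 h2).trans (hp w i k h1 h2)⟩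
  obtain ⟨π, hπ, hπ'⟩ := main hyz
  obtain ⟨ρ, hρ, hρ'⟩ := main hzy
  have inv : ∀ {y z : ℤ → A} (π : hull y → hull z) (ρ : hull z → hull y),
      (∀ w : hull y, ∀ i m, Agree r (w : ℤ → A) i y m → (π w : ℤ → A) i = z m) →
      (∀ w : hull z, ∀ i m, Agree r (w : ℤ → A) i z m → (ρ w : ℤ → A) i = y m) →
        ∀ w, ρ (π w) = w := by
    intro y z π ρ hπ' hρ' w
    ext i
    obtain ⟨m, hm⟩ := loc w (r + r) i
    rw [hρ' _ _ m fun k h1 h2 => hπ' _ _ _ fun l h3 h4 => ?_]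
    · simpa using (hm 0 (by omega) (by omega)).symm
    · rw [add_assoc, add_assoc]
      exact hm (k + l) (by push_cast; omega) (by push_cast; omega)
  refine ⟨⟨⟨π, ρ, inv π ρ hπ' hρ', inv ρ π hρ' hπ'⟩, hπ, hρ⟩, fun v w hvw => ?_⟩
  funext i
  obtain ⟨m, hm⟩ := loc v r (i + 1)
  refine (hπ' w i m fun k h1 h2 => ?_).trans (hπ' v (i + 1) m hm).symm
  rw [hvw, ← hm k h1 h2]
  simp only [shiftMap]
  ring_nf

/-- Shift-commuting continuous maps are given by local rules (Curtis–Hedlund–Lyndon). -/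
theorem exists_determines {O O' : Set (ℤ → A)} (hcpt : IsCompact O)
    (hO : ∀ z ∈ O, ∀ m : ℤ, (fun i => z (i + m)) ∈ O) {e : O → O'} (hcont : Continuous e)
    (he : ∀ x y : O, (y : ℤ → A) = shiftMap A x → (e y : ℤ → A) = shiftMap A (e x)) :
    ∃ R : ℕ, ∀ r, R ≤ r → ∀ z : O, Determines r (z : ℤ → A) (e z : ℤ → A) := by
  have : CompactSpace O := isCompact_iff_compactSpace.1 hcpt
  obtain ⟨R, hR⟩ : ∃ R : ℕ, ∀ z w : O, Agree R (z : ℤ → A) 0 (w : ℤ → A) 0 →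
      (e z : ℤ → A) 0 = (e w : ℤ → A) 0 := by
    by_contra! H
    have hclosed : ∀ N : ℕ, IsClosed {p : O × O | Agree N (p.1 : ℤ → A) 0 (p.2 : ℤ → A) 0 ∧
        (e p.1 : ℤ → A) 0 ≠ (e p.2 : ℤ → A) 0} := fun N =>
      (isClopen_agree (continuous_subtype_val.comp continuous_fst)
        (continuous_subtype_val.comp continuous_snd) N 0 0).isClosed.inter
      (isClopen_apply_eq (continuous_subtype_val.comp (hcont.comp continuous_fst))
        (continuous_subtype_val.comp (hcont.comp continuous_snd)) 0 0).compl.isClosed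
    obtain ⟨⟨z, w⟩, hzw⟩ := IsCompact.nonempty_iInter_of_sequence_nonempty_isCompact_isClosed
      (fun N : ℕ => {p : O × O | Agree N (p.1 : ℤ → A) 0 (p.2 : ℤ → A) 0 ∧
        (e p.1 : ℤ → A) 0 ≠ (e p.2 : ℤ → A) 0})
      (fun N p hp => ⟨hp.1.mono (Nat.le_succ N), hp.2⟩)
      (fun N => by obtain ⟨z, w, h⟩ := H N; exact ⟨(z, w), h⟩)
      (hclosed 0).isCompact hclosed
    rw [Set.mem_iInter] at hzw
    refine (hzw 0).2 ?_
    have : z = w := by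
      ext i
      simpa using (hzw i.natAbs).1 i (by omega) (by omega)
    rw [this]
  refine ⟨R, fun r hr z m n hmn => ?_⟩
  have := hR ⟨_, hO z z.2 m⟩ ⟨_, hO z z.2 n⟩ fun i h1 h2 => by
    have := hmn i (by omega) (by omega)
    simp only [zero_add]
    rw [add_comm i m, add_comm i n, this]
  rw [apply_translate hO he m z ⟨_, hO z z.2 m⟩ rfl,
    apply_translate hO he n z ⟨_, hO z z.2 n⟩ rfl] at this
  simpa using this

end Topology

theorem exists_blockEq_of_finite [TopologicalSpace A] [DiscreteTopology A] {O : Set (ℤ → A)}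
    (hO : IsCompact O) (u : ℕ) (y : ℤ → A)
    (h : ∀ F : Finset (ℤ × ℤ), ∃ z ∈ O, ∀ p ∈ F, BlockEq u y p.1 p.2 ↔ BlockEq u z p.1 p.2) :
    ∃ z ∈ O, ∀ i j, BlockEq u y i j ↔ BlockEq u z i j := by
  have hclosed : ∀ p : ℤ × ℤ, IsClosed {z : ℤ → A | BlockEq u y p.1 p.2 ↔ BlockEq u z p.1 p.2} := by
    intro p
    by_cases hp : BlockEq u y p.1 p.2
    · simpa only [hp, true_iff] using (isClopen_blockEq u p.1 p.2).isClosed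
    · simp only [hp, false_iff]
      exact (isClopen_blockEq u p.1 p.2).compl.isClosed
  obtain ⟨z, hz, hz'⟩ := hO.inter_iInter_nonempty _ hclosed fun F => by
    obtain ⟨z, hz, hF⟩ := h F
    exact ⟨z, hz, Set.mem_iInter₂.2 hF⟩
  exact ⟨z, hz, fun i j => Set.mem_iInter.1 hz' (i, j)⟩

/-- The triples `(u, F, E)` such that `u` is the `t`-th level of `K` and some centered element of
`K` has, among the pairs in `F`, exactly those in `E` as pairs of equal `u`-blocks. -/
def Coded (K : Set (ℤ → A)) (t : ℕ) (c : ℕ × Finset (ℤ × ℤ) × Finset (ℤ × ℤ)) : Prop :=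
  level K t = c.1 ∧ ∃ y ∈ K, Centered c.1 y ∧ ∀ p ∈ c.2.1, p ∈ c.2.2 ↔ BlockEq c.1 y p.1 p.2

theorem shiftMap_mem_hull {x z : ℤ → A} (hz : z ∈ hull x) : shiftMap A z ∈ hull x :=
  translate_mem_hull hz 1

section Reduction

variable [TopologicalSpace A] [DiscreteTopology A]

theorem isCompact_hull [Finite A] {x : ℤ → A} (hx : IsToeplitzSeq A x) : IsCompact (hull x) := by
  rw [← orbitClosure_eq_hull hx]
  exact isClosed_closure.isCompact

theorem Recognizes.of_isTopConj [Finite A] {x x' : ℤ → A} (hx' : IsToeplitzSeq A x')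
    (h : IsTopConj A (hull x') (hull x)) {n : ℕ} (hn : Recognizes (hull x) n) :
    Recognizes (hull x') n := by
  obtain ⟨e, he⟩ := h
  obtain ⟨r, hr⟩ := exists_determines (isCompact_hull hx') (fun z hz => translate_mem_hull hz)
    e.continuous he
  obtain ⟨N, hN⟩ := hn
  refine ⟨N + r, fun z hz a b hab => hN _ (e ⟨z, hz⟩).2 a b fun i h1 h2 => ?_⟩
  refine hr r le_rfl ⟨z, hz⟩ _ _ fun k h3 h4 => ?_
  have := hab (i + k) (by push_cast; omega) (by push_cast; omega)
  convert this using 2 <;> ring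

theorem level_eq_of_isTopConj [Finite A] {x x' : ℤ → A} (hx : IsToeplitzSeq A x)
    (hx' : IsToeplitzSeq A x') (h : IsTopConj A (hull x) (hull x')) (t : ℕ) :
    level (hull x) t = level (hull x') t := by
  have : ∀ n, Recognizes (hull x) n ↔ Recognizes (hull x') n := fun n =>
    ⟨Recognizes.of_isTopConj hx' (IsTopConj.symm_of_invariant (fun _ => shiftMap_mem_hull) h),
      Recognizes.of_isTopConj hx h⟩
  simp only [level, this]

theorem eventually_coded_imp [Finite A] {x x' : ℤ → A} (hx : IsToeplitzSeq A x)
    (hg : HasGrowingBlocks A x (natFactorization A x)) (hx' : IsToeplitzSeq A x')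
    (h : IsTopConj A (hull x) (hull x')) :
    ∀ᶠ t in atTop, ∀ c, Coded (hull x) t c → Coded (hull x') t c := by
  have hlevel := level_eq_of_isTopConj hx hx' h
  obtain ⟨e, he⟩ := h
  have he' : ∀ z w : hull x', (w : ℤ → A) = shiftMap A z →
      (e.symm w : ℤ → A) = shiftMap A (e.symm z) := fun z w hzw => by
    have h1 := he (e.symm z) ⟨_, shiftMap_mem_hull (e.symm z).2⟩ rfl
    rw [e.apply_symm_apply, ← hzw] at h1
    rw [← Subtype.ext h1, e.symm_apply_apply]
  obtain ⟨r₁, hr₁⟩ := exists_determines (isCompact_hull hx) (fun z hz => translate_mem_hull hz)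
    e.continuous he
  obtain ⟨r₂, hr₂⟩ := exists_determines (isCompact_hull hx') (fun z hz => translate_mem_hull hz)
    e.symm.continuous he'
  obtain ⟨T, hT⟩ := filledBlock_growing_hull hx hg (6 * (max r₁ r₂ : ℕ) + 3)
  filter_upwards [eventually_ge_atTop T] with t ht
  rintro ⟨u, F, E⟩ ⟨rfl, y, hy, hcent, hF⟩
  have hzy := hr₂ _ (le_max_right r₁ r₂) (e ⟨y, hy⟩)
  rw [e.symm_apply_apply] at hzy
  obtain ⟨s, hs, hs'⟩ := exists_centered_blockEq (hr₁ _ (le_max_left r₁ r₂) ⟨y, hy⟩) hzy hcent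
    (hT t ht y hy)
  exact ⟨(hlevel t).symm, _, translate_mem_hull (e ⟨y, hy⟩).2 s, hs, fun p hp =>
    (hF p hp).trans (hs' _ _).symm⟩

theorem isTopConj_of_coded [Finite A] {x x' : ℤ → A} (hx : IsToeplitzSeq A x)
    (hx' : IsToeplitzSeq A x')
    (h : ∃ᶠ t in atTop, ∀ c, Coded (hull x) t c → Coded (hull x') t c) :
    IsTopConj A (hull x) (hull x') := by
  classical
  obtain ⟨T, hT⟩ := exists_centered hx
  obtain ⟨t, ht, hc⟩ := Filter.frequently_atTop.1 h T
  obtain ⟨y, hy, hcent⟩ := hT t ht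
  set u := level (hull x) t with hu
  have hcode : ∀ F : Finset (ℤ × ℤ), Coded (hull x') t (u, F, {p ∈ F | BlockEq u y p.1 p.2}) :=
    fun F => hc _ ⟨hu.symm, y, hy, hcent, fun p hp => by simp [hp]⟩
  have hu' : level (hull x') t = u := (hcode ∅).1
  have hu1 : 1 ≤ u := level_pos _ t
  obtain ⟨z, hz, hyz⟩ := exists_blockEq_of_finite (isCompact_hull hx') u y fun F => by
    obtain ⟨-, z, hz, -, hF⟩ := hcode F
    exact ⟨z, hz, fun p hp => by simpa [hp] using hF p hp⟩
  obtain ⟨r₁, hr₁⟩ := determines_of_blockEq hu1 (recognizes_level (hull x) t) hy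
    fun i j => (hyz i j).1
  obtain ⟨r₂, hr₂⟩ := determines_of_blockEq hu1 (hu' ▸ recognizes_level (hull x') t) hz
    fun i j => (hyz i j).2
  rw [← hull_eq hx hy, ← hull_eq hx' hz]
  exact isTopConj_of_determines (hr₁ _ (le_max_left r₁ r₂)) (hr₂ _ (le_max_right r₁ r₂))

end Reduction

section Measurability

theorem measurable_exists_mem [MetricSpace A] {P : (ℤ → A) → Prop} (hP : IsClosed {y | P y}) :
    Measurable fun K : NonemptyCompacts (ℤ → A) => ∃ y ∈ K, P y := by
  have : BorelSpace (NonemptyCompacts (ℤ → A)) := ⟨rfl⟩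
  exact measurableSet_setOfPred.1
    (NonemptyCompacts.isClosed_inter_nonempty_of_isClosed hP).measurableSet

variable [Fintype A] [MetricSpace A]

theorem measurable_recognizes (n : ℕ) :
    Measurable fun K : NonemptyCompacts (ℤ → A) => Recognizes (K : Set (ℤ → A)) n := by
  have : ∀ K : NonemptyCompacts (ℤ → A), Recognizes (K : Set (ℤ → A)) n ↔
      ∃ N : ℕ, ∀ a b : ℤ, ¬ ∃ y ∈ K, Agree N y a y b ∧ ¬ (n : ℤ) ∣ a - b := by
    intro K
    simp only [Recognizes, not_exists, not_and, not_not, SetLike.mem_coe]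
    exact exists_congr fun N => ⟨fun h a b y hy => h y hy a b, fun h y hy a b => h a b y hy⟩
  simp only [this]
  refine Measurable.exists fun N => Measurable.forall fun a => Measurable.forall fun b =>
    (measurable_exists_mem ?_).not
  exact (isClopen_agree continuous_id continuous_id N a b).isClosed.inter isClosed_const

theorem measurable_level (t : ℕ) :
    Measurable fun K : NonemptyCompacts (ℤ → A) => level (K : Set (ℤ → A)) t := by
  refine Finset.measurable_fun_prod _ fun i _ => ?_
  set p := Nat.nth Nat.Prime i
  have h : Measurable fun (K : NonemptyCompacts (ℤ → A)) (j : Fin (t + 2)) =>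
      Recognizes (K : Set (ℤ → A)) (p ^ (j : ℕ)) :=
    measurable_pi_lambda _ fun j => measurable_recognizes _
  have hg : Measurable fun b : Fin (t + 2) → Prop =>
      p ^ sSup {j : ℕ | ∃ hj : j < t + 2, b ⟨j, hj⟩} := Measurable.of_discrete
  have heq : (fun K : NonemptyCompacts (ℤ → A) =>
      p ^ sSup {j : ℕ | j ≤ t + 1 ∧ Recognizes (K : Set (ℤ → A)) (p ^ j)}) =
      (fun b : Fin (t + 2) → Prop => p ^ sSup {j : ℕ | ∃ hj : j < t + 2, b ⟨j, hj⟩}) ∘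
        fun (K : NonemptyCompacts (ℤ → A)) (j : Fin (t + 2)) =>
          Recognizes (K : Set (ℤ → A)) (p ^ (j : ℕ)) := by
    funext K
    simp only [Function.comp_apply, exists_prop, Nat.lt_succ_iff]
  exact heq ▸ hg.comp h

theorem measurable_coded (t : ℕ) (c : ℕ × Finset (ℤ × ℤ) × Finset (ℤ × ℤ)) :
    Measurable fun K : NonemptyCompacts (ℤ → A) => Coded (K : Set (ℤ → A)) t c := by
  obtain ⟨u, F, E⟩ := c
  have hclopen : ∀ i j : ℤ, IsClopen {y : ℤ → A | y i = y j} := fun i j =>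
    isClopen_apply_eq continuous_id continuous_id i j
  have : ∀ K : NonemptyCompacts (ℤ → A), (∃ y ∈ (K : Set (ℤ → A)), Centered u y ∧
        ∀ p ∈ F, p ∈ E ↔ BlockEq u y p.1 p.2) ↔
      ∃ a b k l : ℤ, ∃ y ∈ K, ((a ≤ b ∧ (a + b = 0 ∨ a + b = 1)) ∧
        (∀ j : ℤ, a ≤ j → j ≤ b → ∀ k : ℤ, y (j + u * k) = y j) ∧
        ¬ y (a - 1 + u * k) = y (a - 1) ∧ ¬ y (b + 1 + u * l) = y (b + 1)) ∧
        ∀ p ∈ F, p ∈ E ↔ BlockEq u y p.1 p.2 := by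
    intro K
    constructor
    · rintro ⟨y, hy, ⟨a, b, ⟨hab, hfill, ha, hb⟩, hsum⟩, hF⟩
      obtain ⟨k, hk⟩ := not_forall.1 ha
      obtain ⟨l, hl⟩ := not_forall.1 hb
      exact ⟨a, b, k, l, y, hy, ⟨⟨hab, hsum⟩, hfill, hk, hl⟩, hF⟩
    · rintro ⟨a, b, k, l, y, hy, ⟨⟨hab, hsum⟩, hfill, hk, hl⟩, hF⟩
      exact ⟨y, hy, ⟨a, b, ⟨hab, hfill, fun h => hk (h k), fun h => hl (h l)⟩, hsum⟩, hF⟩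
  have hfilled : ∀ a b : ℤ,
      IsClosed {y : ℤ → A | ∀ j : ℤ, a ≤ j → j ≤ b → ∀ k : ℤ, y (j + u * k) = y j} := by
    intro a b
    simp only [Set.ofPred_forall]
    exact isClosed_iInter fun j => isClosed_iInter fun _ => isClosed_iInter fun _ =>
      isClosed_iInter fun k => (hclopen _ _).isClosed
  have hpattern : IsClosed {y : ℤ → A | ∀ p ∈ F, p ∈ E ↔ BlockEq u y p.1 p.2} := by
    simp only [Set.ofPred_forall]
    refine isClosed_iInter fun p => isClosed_iInter fun _ => ?_
    by_cases hp : p ∈ E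
    · simpa only [hp, true_iff] using (isClopen_blockEq u p.1 p.2).isClosed
    · simp only [hp, false_iff]
      exact (isClopen_blockEq u p.1 p.2).compl.isClosed
  simp only [Coded, this]
  refine Measurable.and (measurableSet_setOfPred.1
    (measurable_level t (measurableSet_singleton u))) ?_
  refine Measurable.exists fun a => Measurable.exists fun b => Measurable.exists fun k =>
    Measurable.exists fun l => measurable_exists_mem ?_
  exact (isClosed_const.inter ((hfilled a b).inter ((hclopen _ _).compl.isClosed.inter
    (hclopen _ _).compl.isClosed))).inter hpattern

end Measurability

end ToeplitzConj

/-- the topological conjugacy relation on the standard Borel space `T**` of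
Toeplitz subshifts with growing blocks is Borel reducible to `E₁`, the relation of eventual
equality on `(2^ℕ)^ℕ`. -/
theorem stmt2 (A : Type) [Fintype A] [MetricSpace A] (h2 : 2 ≤ Fintype.card A) :
    ∃ f : ToeplitzGrowingBlocks A → (ℕ → ℕ → Bool),
      Measurable f ∧
      ∀ O O' : ToeplitzGrowingBlocks A,
        IsTopConj A ((O : NonemptyCompacts (ℤ → A)) : Set (ℤ → A))
            ((O' : NonemptyCompacts (ℤ → A)) : Set (ℤ → A)) ↔
          ∀ᶠ n in Filter.atTop, f O n = f O' n := by
  classical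
  refine ⟨fun O t n => decide (ToeplitzConj.Coded ((O : NonemptyCompacts (ℤ → A)) : Set (ℤ → A)) t
    (Denumerable.ofNat (ℕ × Finset (ℤ × ℤ) × Finset (ℤ × ℤ)) n)), ?_, ?_⟩
  · refine measurable_pi_lambda _ fun t => measurable_pi_lambda _ fun n => measurable_to_bool ?_
    have := measurableSet_setOfPred.2 ((ToeplitzConj.measurable_coded t
      (Denumerable.ofNat (ℕ × Finset (ℤ × ℤ) × Finset (ℤ × ℤ)) n)).comp
      (measurable_subtype_coe (p := (· ∈ ToeplitzGrowingBlocks A))))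
    convert this using 1
    ext O
    simp
  · rintro ⟨K, x, hx, hK, hg⟩ ⟨K', x', hx', hK', hg'⟩
    rw [ToeplitzConj.orbitClosure_eq_hull hx] at hK
    rw [ToeplitzConj.orbitClosure_eq_hull hx'] at hK'
    simp only [hK, hK', funext_iff, decide_eq_decide]
    refine ⟨fun h => ?_, fun h => ?_⟩
    · filter_upwards [ToeplitzConj.eventually_coded_imp hx hg hx' h,
        ToeplitzConj.eventually_coded_imp hx' hg' hx
          (ToeplitzConj.IsTopConj.symm_of_invariant (fun _ => ToeplitzConj.shiftMap_mem_hull) h)]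
      with t h1 h2 n
      exact ⟨h1 _, h2 _⟩
    · refine ToeplitzConj.isTopConj_of_coded hx hx' (h.frequently.mono fun t ht c => ?_)
      obtain ⟨n, rfl⟩ := (Denumerable.eqv (ℕ × Finset (ℤ × ℤ) × Finset (ℤ × ℤ))).symm.surjective c
      exact (ht n).1
end

section
/- If E is a countable Borel equivalence relation on a standard Borel space X and E is Borel reducible to E_1, then E is hyperfinite. -/
open Filter

open Set MeasureTheory Topology TopologicalSpace

/-- `S` is a countable union of Borel sets on each of which `g` is injective. -/
def IsSigmaInjOn {X Y : Type*} [MeasurableSpace X] (g : X → Y) (S : Set X) : Prop :=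
  ∃ B : ℕ → Set X, (∀ i, MeasurableSet (B i)) ∧ (∀ i, InjOn g (B i)) ∧ S = ⋃ i, B i

section SigmaInjOn

variable {X Y : Type*} [MeasurableSpace X] {g : X → Y}

theorem IsSigmaInjOn.measurableSet {S : Set X} (h : IsSigmaInjOn g S) : MeasurableSet S := by
  obtain ⟨B, hB, -, rfl⟩ := h
  exact MeasurableSet.iUnion hB

theorem isSigmaInjOn_of_injOn {S : Set X} (hS : MeasurableSet S) (hg : InjOn g S) :
    IsSigmaInjOn g S :=
  ⟨fun _ => S, fun _ => hS, fun _ => hg, (iUnion_const S).symm⟩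

theorem IsSigmaInjOn.iUnion {ι : Type*} [Countable ι] {S : ι → Set X}
    (h : ∀ i, IsSigmaInjOn g (S i)) : IsSigmaInjOn g (⋃ i, S i) := by
  cases isEmpty_or_nonempty ι
  · simpa using isSigmaInjOn_of_injOn MeasurableSet.empty (injOn_empty g)
  · choose B hB hinj hS using h
    obtain ⟨e, he⟩ := exists_surjective_nat (ι × ℕ)
    refine ⟨fun n => B (e n).1 (e n).2, fun n => hB _ _, fun n => hinj _ _, ?_⟩
    rw [he.iUnion_comp (fun p : ι × ℕ => B p.1 p.2), iUnion_prod']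
    exact iUnion_congr hS

theorem IsSigmaInjOn.union {S T : Set X} (hS : IsSigmaInjOn g S) (hT : IsSigmaInjOn g T) :
    IsSigmaInjOn g (S ∪ T) := by
  rw [union_eq_iUnion]
  exact IsSigmaInjOn.iUnion fun b => by cases b <;> assumption

end SigmaInjOn

theorem analyticSet_setOf_exists_eq_ne {X Y Z : Type*} [TopologicalSpace X] [PolishSpace X]
    [MeasurableSpace X] [BorelSpace X] [MeasurableSpace Y] [StandardBorelSpace Y]
    [MeasurableSpace Z] [StandardBorelSpace Z] {g : X → Y} (hg : Measurable g)
    {w : Z → X} (hw : Measurable w) {K : Set Z} (hK : MeasurableSet K) :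
    AnalyticSet {x | ∃ z ∈ K, g (w z) = g x ∧ w z ≠ x} := by
  have h : MeasurableSet {p : Z × X | p.1 ∈ K ∧ g (w p.1) = g p.2 ∧ w p.1 ≠ p.2} :=
    (measurable_fst hK).inter ((measurableSet_eq_fun (hg.comp (hw.comp measurable_fst))
      (hg.comp measurable_snd)).inter
      (measurableSet_eq_fun (hw.comp measurable_fst) measurable_snd).compl)
  convert h.analyticSet_image measurable_snd using 1
  ext x
  simp

/-- An analytic set on which `g` is injective extends to a Borel set on which `g` is injective. -/
theorem exists_measurableSet_superset_injOn {X Y Z : Type*} [TopologicalSpace X] [PolishSpace X]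
    [MeasurableSpace X] [BorelSpace X] [MeasurableSpace Y] [StandardBorelSpace Y]
    [MeasurableSpace Z] [StandardBorelSpace Z] {g : X → Y} (hg : Measurable g)
    {w : Z → X} (hw : Measurable w) {K : Set Z} (hK : MeasurableSet K)
    (hinj : InjOn g (w '' K)) :
    ∃ B, MeasurableSet B ∧ w '' K ⊆ B ∧ InjOn g B := by
  obtain ⟨C, hAC, hC', hC⟩ := (hK.analyticSet_image hw).measurablySeparable
    (analyticSet_setOf_exists_eq_ne hg hw hK) (by
      rw [disjoint_left]
      rintro x hx ⟨z, hz, hgz, hne⟩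
      exact hne (hinj (mem_image_of_mem w hz) hx hgz))
  obtain ⟨D, hAD, hD', hD⟩ := (hK.analyticSet_image hw).measurablySeparable
    (analyticSet_setOf_exists_eq_ne hg measurable_id hC) (by
      rw [disjoint_left]
      rintro _ ⟨z, hz, rfl⟩ ⟨c, hc, hgc, hne⟩
      exact disjoint_left.1 hC' ⟨z, hz, hgc.symm, hne.symm⟩ hc)
  refine ⟨C ∩ D, hC.inter hD, subset_inter hAC hAD, fun a ha b hb hab => ?_⟩
  by_contra hne
  exact disjoint_left.1 hD' ⟨a, ha.1, hab, hne⟩ hb.2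

/-- A set of families of points of `X`, given through the parametrization `q`, is large if no
countable union of Borel sets on which `g` is injective meets every family. -/
def IsLargeFamily {X Y P : Type*} [MeasurableSpace X] (g : X → Y) (q : P → X)
    (H : Set (List Bool → P)) : Prop :=
  ∀ S, IsSigmaInjOn g S → ∃ h ∈ H, ∀ s, q (h s) ∉ S

theorem IsLargeFamily.nonempty {X Y P : Type*} [MeasurableSpace X] {g : X → Y} {q : P → X}
    {H : Set (List Bool → P)} (hH : IsLargeFamily g q H) : H.Nonempty := by
  obtain ⟨h, hh, -⟩ := hH ∅ (isSigmaInjOn_of_injOn MeasurableSet.empty (injOn_empty g))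
  exact ⟨h, hh⟩

theorem IsLargeFamily.exists_of_subset_iUnion {X Y P ι : Type*} [MeasurableSpace X] {g : X → Y}
    {q : P → X} [Countable ι] {H : Set (List Bool → P)} (hH : IsLargeFamily g q H)
    {K : ι → Set (List Bool → P)} (hK : H ⊆ ⋃ i, K i) : ∃ i, IsLargeFamily g q (K i) := by
  by_contra! hcon
  simp only [IsLargeFamily, not_forall, not_exists, not_and, not_not] at hcon
  choose S hS hmeet using hcon
  obtain ⟨h, hh, hn⟩ := hH _ (IsSigmaInjOn.iUnion hS)
  obtain ⟨i, hi⟩ := mem_iUnion.1 (hK hh)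
  obtain ⟨s, hs⟩ := hmeet i h hi
  exact hn s (mem_iUnion_of_mem i hs)

/-- Pairs of families in `H`, joined along the head of the index, whose `σ`-th points lie in one
fiber of `g`, are separated by the `k`-th coordinate of `r`, and such that the first `n` values of
the points with index of length `n` are prescribed by `u`. -/
def doubleFamily {Y : Type*} (g : (ℕ → ℕ) → Y) (r : (ℕ → ℕ) → ℕ → Bool)
    (H : Set (List Bool → ℕ → ℕ)) (σ : List Bool) (n k : ℕ) (v : Bool)
    (u : List Bool → ℕ → ℕ) : Set (List Bool → ℕ → ℕ) :=
  {h | (∀ b, (fun s => h (b :: s)) ∈ H) ∧ g (h (false :: σ)) = g (h (true :: σ)) ∧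
    (∀ b, r (h (b :: σ)) k = xor b v) ∧ ∀ s, s.length = n → ∀ i < n, h s i = u s i}

theorem measurableSet_doubleFamily {Y : Type*} [MeasurableSpace Y] [StandardBorelSpace Y]
    {g : (ℕ → ℕ) → Y} (hg : Measurable g) {r : (ℕ → ℕ) → ℕ → Bool} (hr : Measurable r)
    {H : Set (List Bool → ℕ → ℕ)} (hH : MeasurableSet H) (σ : List Bool) (n k : ℕ) (v : Bool)
    (u : List Bool → ℕ → ℕ) : MeasurableSet (doubleFamily g r H σ n k v u) := by
  refine MeasurableSet.inter ?_ (MeasurableSet.inter ?_ (MeasurableSet.inter ?_ ?_))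
  · refine measurableSet_setOfPred.2 (Measurable.forall fun b => ?_)
    exact measurableSet_setOfPred.1 ((measurable_pi_lambda _ fun s => measurable_pi_apply _) hH)
  · exact measurableSet_eq_fun (hg.comp (measurable_pi_apply _)) (hg.comp (measurable_pi_apply _))
  · refine measurableSet_setOfPred.2 (Measurable.forall fun b => measurableSet_setOfPred.1 ?_)
    exact measurableSet_eq_fun
      ((measurable_pi_apply k).comp (hr.comp (measurable_pi_apply _))) measurable_const
  · refine measurableSet_setOfPred.2 (Measurable.forall fun s => Measurable.forall fun _ =>
      Measurable.forall fun i => Measurable.forall fun _ => measurableSet_setOfPred.1 ?_)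
    exact measurableSet_eq_fun
      ((measurable_pi_apply i).comp (measurable_pi_apply s)) measurable_const

theorem IsLargeFamily.exists_doubleFamily {X Y : Type*} [TopologicalSpace X] [PolishSpace X]
    [MeasurableSpace X] [BorelSpace X] [MeasurableSpace Y] [StandardBorelSpace Y]
    {g : X → Y} (hg : Measurable g) {r : X → ℕ → Bool} (hrinj : Function.Injective r)
    {q : (ℕ → ℕ) → X} (hq : Measurable q)
    {H : Set (List Bool → ℕ → ℕ)} (hHm : MeasurableSet H) (hH : IsLargeFamily g q H)
    (σ : List Bool) (n : ℕ) :
    ∃ k v u, IsLargeFamily g q (doubleFamily (g ∘ q) (r ∘ q) H σ n k v u) := by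
  have hpair : IsLargeFamily g q {h | (∀ b, (fun s => h (b :: s)) ∈ H) ∧
      g (q (h (false :: σ))) = g (q (h (true :: σ))) ∧
      q (h (false :: σ)) ≠ q (h (true :: σ))} := by
    intro S hS
    by_contra! hcon
    have hw : Measurable fun h : List Bool → ℕ → ℕ => q (h σ) := hq.comp (measurable_pi_apply σ)
    have hK : MeasurableSet (H ∩ {h | ∀ s, q (h s) ∉ S}) := by
      refine hHm.inter (measurableSet_setOfPred.2 (Measurable.forall fun s => ?_))
      exact measurableSet_setOfPred.1 (hq.comp (measurable_pi_apply s) hS.measurableSet.compl)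
    obtain ⟨B, hB, hsub, hinj⟩ := exists_measurableSet_superset_injOn hg hw hK (by
      rintro _ ⟨a, ha, rfl⟩ _ ⟨b, hb, rfl⟩ hab
      by_contra hne
      obtain ⟨s, hs⟩ := hcon (fun s => match s with
        | [] => a []
        | false :: s => a s
        | true :: s => b s) ⟨fun c => by cases c <;> simp [ha.1, hb.1], hab, hne⟩
      match s with
      | [] => exact ha.2 _ hs
      | false :: s => exact ha.2 _ hs
      | true :: s => exact hb.2 _ hs)
    obtain ⟨h, hh, hn⟩ := hH _ (hS.union (isSigmaInjOn_of_injOn hB hinj))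
    exact hn σ (Or.inr (hsub ⟨h, ⟨hh, fun s hs => hn s (Or.inl hs)⟩, rfl⟩))
  have : Finite {s : List Bool // s.length = n} := (List.finite_length_eq Bool n).to_subtype
  obtain ⟨⟨k, v, u⟩, hu⟩ := hpair.exists_of_subset_iUnion
    (K := fun d : ℕ × Bool × ({s : List Bool // s.length = n} → Fin n → ℕ) =>
      doubleFamily (g ∘ q) (r ∘ q) H σ n d.1 d.2.1
        (fun s i => if hs : s.length = n ∧ i < n then d.2.2 ⟨s, hs.1⟩ ⟨i, hs.2⟩ else 0)) (by
    rintro h ⟨hmem, heq, hne⟩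
    obtain ⟨k, hk⟩ := Function.ne_iff.1 (hrinj.ne hne)
    refine mem_iUnion.2 ⟨⟨k, r (q (h (false :: σ))) k, fun s i => h s i⟩, hmem, heq, ?_, ?_⟩
    · intro b
      cases b
      · simp
      · revert hk
        simp only [Function.comp]
        cases r (q (h (false :: σ))) k <;> cases r (q (h (true :: σ))) k <;> simp
    · intro s hs i hi
      simp [hs, hi])
  exact ⟨k, v, _, hu⟩

/-- The first `n` values of `x`, listed in decreasing order of their index. -/
def revPrefix (x : ℕ → Bool) : ℕ → List Bool
  | 0 => []
  | n + 1 => x n :: revPrefix x n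

theorem length_revPrefix (x : ℕ → Bool) (n : ℕ) : (revPrefix x n).length = n := by
  induction n with
  | zero => rfl
  | succ n ih => simp [revPrefix, ih]

theorem revPrefix_congr {x y : ℕ → Bool} {n : ℕ} (h : ∀ i < n, x i = y i) :
    revPrefix x n = revPrefix y n := by
  induction n with
  | zero => rfl
  | succ n ih => rw [revPrefix, revPrefix, h n n.lt_succ_self, ih fun i hi => h i (by omega)]

theorem continuous_comp_revPrefix (F : List Bool → ℕ) (n : ℕ) :
    Continuous fun x : ℕ → Bool => F (revPrefix x n) := by
  induction n generalizing F with
  | zero => exact continuous_const (y := F [])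
  | succ n ih =>
    have h : Continuous fun p : Bool × ℕ × ℕ => bif p.1 then p.2.1 else p.2.2 :=
      continuous_of_discreteTopology
    have hn : Continuous fun x : ℕ → Bool => x n := continuous_apply n
    refine (h.comp (hn.prodMk
      ((ih fun s => F (true :: s)).prodMk (ih fun s => F (false :: s))))).congr fun x => ?_
    simp only [Function.comp, revPrefix]
    cases x n <;> rfl

/-- There is a sequence of branches that is dense, even modulo finite initial segments. -/
theorem exists_seq_revPrefix_eq : ∃ d : ℕ → ℕ → Bool, ∀ V : Set (ℕ → Bool), IsOpen V →
    V.Nonempty → ∃ n, ∃ x ∈ V, ∃ y ∈ V, revPrefix x n = revPrefix (d n) n ∧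
      revPrefix y n = revPrefix (d n) n ∧ x n = false ∧ y n = true := by
  refine ⟨fun n => TopologicalSpace.denseSeq (ℕ → Bool) n.unpair.1, fun V hV hne => ?_⟩
  obtain ⟨_, hmem, i, rfl⟩ := (TopologicalSpace.denseRange_denseSeq (ℕ → Bool)).inter_open_nonempty
    V hV hne
  set z := TopologicalSpace.denseSeq (ℕ → Bool) i with hz
  have key : ∀ b : Bool, ∀ᶠ n in atTop, Function.update z n b ∈ V := by
    intro b
    suffices h : Tendsto (fun n => Function.update z n b) atTop (𝓝 z) from
      h.eventually_mem (hV.mem_nhds hmem)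
    refine tendsto_pi_nhds.2 fun j => tendsto_const_nhds.congr' ?_
    filter_upwards [eventually_gt_atTop j] with n hn
    rw [Function.update_of_ne hn.ne]
  obtain ⟨N, hN⟩ := eventually_atTop.1 ((key false).and (key true))
  obtain ⟨h₁, h₂⟩ := hN (Nat.pair i N) (Nat.right_le_pair i N)
  refine ⟨Nat.pair i N, _, h₁, _, h₂, ?_, ?_, by simp, by simp⟩ <;>
  · simp only [Nat.unpair_pair]
    exact revPrefix_congr fun j hj => by rw [Function.update_of_ne hj.ne]

theorem exists_measurable_surjective_continuous_comp {X W : Type*} [MeasurableSpace X]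
    [StandardBorelSpace X] [Nonempty X] [TopologicalSpace W] [PolishSpace W] [MeasurableSpace W]
    [BorelSpace W] {e : X → W} (he : Measurable e) (hinj : Function.Injective e) :
    ∃ q : (ℕ → ℕ) → X, Measurable q ∧ Function.Surjective q ∧ Continuous (e ∘ q) := by
  have hA : AnalyticSet (range e) := by
    simpa using MeasurableSet.univ.analyticSet_image he
  rw [AnalyticSet] at hA
  obtain ⟨p, hp, hrange⟩ := hA.resolve_left (range_nonempty e).ne_empty
  choose q hq using fun z => (hrange ▸ mem_range_self z : p z ∈ range e)
  have heq : e ∘ q = p := funext hq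
  refine ⟨q, ?_, fun x => ?_, heq ▸ hp⟩
  · rw [← (he.measurableEmbedding hinj).measurable_comp_iff, heq]
    exact hp.measurable
  · obtain ⟨z, hz⟩ := (hrange ▸ mem_range_self x : e x ∈ range p)
    exact ⟨z, hinj ((hq z).trans hz)⟩

theorem IsLargeFamily.exists_seq_doubleFamily {X Y : Type*} [TopologicalSpace X] [PolishSpace X]
    [MeasurableSpace X] [BorelSpace X] [MeasurableSpace Y] [StandardBorelSpace Y]
    {g : X → Y} (hg : Measurable g) {r : X → ℕ → Bool} (hr : Measurable r)
    (hrinj : Function.Injective r) {q : (ℕ → ℕ) → X} (hq : Measurable q)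
    (h₀ : IsLargeFamily g q univ) (σ : ℕ → List Bool) :
    ∃ (H : ℕ → Set (List Bool → ℕ → ℕ)) (k : ℕ → ℕ) (v : ℕ → Bool) (u : ℕ → List Bool → ℕ → ℕ),
      (∀ n, (H n).Nonempty) ∧ ∀ n, H (n + 1) =
        doubleFamily (g ∘ q) (r ∘ q) (H n) (σ n) (n + 1) (k n) (v n) (u n) := by
  let T := {H : Set (List Bool → ℕ → ℕ) // MeasurableSet H ∧ IsLargeFamily g q H}
  choose k v u hlarge using fun (H : T) (n : ℕ) =>
    H.2.2.exists_doubleFamily hg hrinj hq H.2.1 (σ n) (n + 1)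
  let H : ℕ → T := fun n => n.rec ⟨univ, MeasurableSet.univ, h₀⟩ fun n H =>
    ⟨_, measurableSet_doubleFamily (hg.comp hq) (hr.comp hq) H.2.1 _ _ _ _ _, hlarge H n⟩
  exact ⟨fun n => (H n).1, fun n => k (H n) n, fun n => v (H n) n, fun n => u (H n) n,
    fun n => (H n).2.2.nonempty, fun n => rfl⟩

theorem exists_continuous_of_seq_doubleFamily {Y : Type*} [TopologicalSpace Y] [T2Space Y]
    {g : (ℕ → ℕ) → Y} (hg : Continuous g) {r : (ℕ → ℕ) → ℕ → Bool} (hr : Continuous r)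
    {H : ℕ → Set (List Bool → ℕ → ℕ)} {σ : ℕ → List Bool} (hσ : ∀ n, (σ n).length = n)
    {k : ℕ → ℕ} {v : ℕ → Bool} {u : ℕ → List Bool → ℕ → ℕ} (hne : ∀ n, (H n).Nonempty)
    (hH : ∀ n, H (n + 1) = doubleFamily g r (H n) (σ n) (n + 1) (k n) (v n) (u n)) :
    ∃ φ : (ℕ → Bool) → ℕ → ℕ, Continuous φ ∧ (∀ x y, g (φ x) = g (φ y)) ∧
      ∀ n x, revPrefix x n = σ n → r (φ x) (k n) = xor (x n) (v n) := by
  have hmem : ∀ {n h}, h ∈ H (n + 1) → ∀ b, (fun s => h (b :: s)) ∈ H n := fun {n h} hh =>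
    (hH n ▸ hh : h ∈ doubleFamily g r (H n) (σ n) (n + 1) (k n) (v n) (u n)).1
  have hfib : ∀ n, ∀ h ∈ H n, ∀ s t : List Bool, s.length = n → t.length = n →
      g (h s) = g (h t) := by
    intro n
    induction n with
    | zero =>
      intro h _ s t hs ht
      rw [List.length_eq_zero_iff.1 hs, List.length_eq_zero_iff.1 ht]
    | succ n ih =>
      intro h hh
      have hbase : ∀ b s, s.length = n → g (h (b :: s)) = g (h (false :: σ n)) := by
        intro b s hs
        rw [ih _ (hmem hh b) s (σ n) hs (hσ n)]
        cases b
        · rfl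
        · rw [hH n] at hh
          exact hh.2.1.symm
      rintro (_ | ⟨a, s⟩) (_ | ⟨b, t⟩) hs ht
      · simp at hs
      · simp at hs
      · simp at ht
      · rw [hbase a s (by simpa using hs), hbase b t (by simpa using ht)]
  have hsep : ∀ n, ∀ h ∈ H n, ∀ x, ∀ m < n, revPrefix x m = σ m →
      r (h (revPrefix x n)) (k m) = xor (x m) (v m) := by
    intro n
    induction n with
    | zero => simp
    | succ n ih =>
      intro h hh x m hm hx
      obtain rfl | hlt := (Nat.lt_succ_iff.1 hm).eq_or_lt
      · rw [hH m] at hh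
        rw [revPrefix, hx]
        exact hh.2.2.1 (x m)
      · exact ih _ (hmem hh (x n)) x m hlt hx
  have hpre : ∀ n, ∀ h ∈ H n, ∀ x, ∀ i < n,
      h (revPrefix x n) i = u i (revPrefix x (i + 1)) i := by
    intro n
    induction n with
    | zero => simp
    | succ n ih =>
      intro h hh x i hi
      obtain rfl | hlt := (Nat.lt_succ_iff.1 hi).eq_or_lt
      · rw [hH i] at hh
        exact hh.2.2.2 _ (length_revPrefix x _) i hi
      · exact ih _ (hmem hh (x n)) x i hlt
  choose h hh using hne
  let φ : (ℕ → Bool) → ℕ → ℕ := fun x i => u i (revPrefix x (i + 1)) i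
  have hlim : ∀ x, Tendsto (fun n => h n (revPrefix x n)) atTop (𝓝 (φ x)) := by
    intro x
    refine tendsto_pi_nhds.2 fun i => tendsto_const_nhds.congr' ?_
    filter_upwards [eventually_gt_atTop i] with n hn
    exact (hpre n (h n) (hh n) x i hn).symm
  refine ⟨φ, continuous_pi fun i => continuous_comp_revPrefix (fun s => u i s i) (i + 1),
    fun x y => ?_, fun m x hx => ?_⟩
  · refine tendsto_nhds_unique ((hg.tendsto _).comp (hlim x))
      (((hg.tendsto _).comp (hlim y)).congr fun n => ?_)
    exact hfib n (h n) (hh n) _ _ (length_revPrefix y n) (length_revPrefix x n)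
  · refine tendsto_nhds_unique
      ((((continuous_apply (k m)).comp hr).tendsto _).comp (hlim x))
      (tendsto_const_nhds.congr' ?_)
    filter_upwards [eventually_gt_atTop m] with n hn
    exact (hsep n (h n) (hh n) x m hn hx).symm

/-- **Lusin–Novikov**: a Borel map with countable fibers is injective on each piece of some
countable Borel cover. -/
theorem isSigmaInjOn_univ_of_countable_fibers {X Y : Type*} [MeasurableSpace X]
    [StandardBorelSpace X] [MeasurableSpace Y] [StandardBorelSpace Y] {g : X → Y}
    (hg : Measurable g) (hcount : ∀ x, {x' | g x = g x'}.Countable) :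
    IsSigmaInjOn g univ := by
  cases isEmpty_or_nonempty X
  · exact isSigmaInjOn_of_injOn MeasurableSet.univ fun x => isEmptyElim x
  by_contra hsmall
  obtain ⟨r, hr, hrinj⟩ := MeasurableSpace.measurable_injection_nat_bool_of_countablySeparated X
  let _ := upgradeStandardBorel X
  let _ := upgradeStandardBorel Y
  have : IsCompletelyMetrizableSpace (ℕ → Bool) := inferInstance
  have : PolishSpace (ℕ → Bool) := ⟨⟩
  obtain ⟨q, hq, hqsurj, hcont⟩ := exists_measurable_surjective_continuous_comp (hg.prodMk hr)
    fun x y hxy => hrinj (congrArg Prod.snd hxy)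
  have hgq : Continuous (g ∘ q) := continuous_fst.comp hcont
  have hrq : Continuous (r ∘ q) := continuous_snd.comp hcont
  have hlarge : IsLargeFamily g q univ := by
    intro S hS
    obtain ⟨x, hx⟩ := (ne_univ_iff_exists_notMem S).1 fun h => hsmall (h ▸ hS)
    obtain ⟨z, rfl⟩ := hqsurj x
    exact ⟨fun _ => z, mem_univ _, fun _ => hx⟩
  obtain ⟨d, hd⟩ := exists_seq_revPrefix_eq
  obtain ⟨H, k, v, u, hne, hH⟩ := hlarge.exists_seq_doubleFamily hg hr hrinj hq
    fun n => revPrefix (d n) n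
  obtain ⟨φ, hφ, hconst, hsep⟩ := exists_continuous_of_seq_doubleFamily hgq hrq
    (fun n => length_revPrefix (d n) n) hne hH
  have : Countable {x' | g (q (φ default)) = g x'} := (hcount _).to_subtype
  obtain ⟨c, hc⟩ := nonempty_interior_of_iUnion_of_closed
    (f := fun c : {x' | g (q (φ default)) = g x'} => {x | r (q (φ x)) = r c})
    (fun c => isClosed_eq (hrq.comp hφ) continuous_const)
    (eq_univ_of_forall fun x => mem_iUnion.2 ⟨⟨q (φ x), hconst _ _⟩, rfl⟩)
  obtain ⟨n, x, hx, y, hy, hxn, hyn, hx0, hy1⟩ := hd _ isOpen_interior hc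
  have hxy : r (q (φ x)) = r (q (φ y)) := by
    have hxc := interior_subset hx
    have hyc := interior_subset hy
    rw [mem_ofPred_eq] at hxc hyc
    rw [hxc, hyc]
  have h₁ := hsep n x hxn
  have h₂ := hsep n y hyn
  simp only [Function.comp] at h₁ h₂
  rw [hxy, h₂, hx0, hy1] at h₁
  simp at h₁

/-- If `g` refines a Borel map `g'` with countable fibers, then the fibers of `g` inside each fiber
of `g'` can be numbered in a Borel way. -/
theorem exists_measurable_nat_separating_fibers {X Y Y' : Type*} [MeasurableSpace X]
    [StandardBorelSpace X] [MeasurableSpace Y] [StandardBorelSpace Y] [MeasurableSpace Y']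
    [StandardBorelSpace Y'] {g : X → Y} (hg : Measurable g) {g' : X → Y'} (hg' : Measurable g')
    (hcount : ∀ x, {x' | g' x = g' x'}.Countable) (hgg' : ∀ x y, g x = g y → g' x = g' y) :
    ∃ k : X → ℕ, Measurable k ∧ (∀ x y, g x = g y → k x = k y) ∧
      ∀ x y, g' x = g' y → k x = k y → g x = g y := by
  classical
  obtain ⟨B, hB, hinj, hcover⟩ := isSigmaInjOn_univ_of_countable_fibers hg' hcount
  have hex : ∀ x, ∃ i, x ∈ g ⁻¹' (g '' B i) := fun x => by
    obtain ⟨i, hi⟩ := mem_iUnion.1 (hcover ▸ mem_univ x)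
    exact ⟨i, mem_image_of_mem g hi⟩
  have hmeas : ∀ i, MeasurableSet (g ⁻¹' (g '' B i)) := fun i =>
    hg ((hB i).image_of_measurable_injOn hg fun x hx y hy hxy => hinj i hx hy (hgg' x y hxy))
  refine ⟨fun x => Nat.find (hex x), measurable_find hex hmeas, fun x y hxy => ?_,
    fun x y hxy hk => ?_⟩
  · simp only [mem_preimage, hxy]
  · obtain ⟨a, ha, hax⟩ := Nat.find_spec (hex x)
    obtain ⟨b, hb, hby⟩ := Nat.find_spec (hex y)
    dsimp only at hk
    rw [hk] at ha
    have hab : a = b := hinj _ ha hb (by rw [hgg' a x hax, hgg' b y hby, hxy])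
    rw [← hax, ← hby, hab]

/-- a countable Borel equivalence relation that is Borel reducible to `E₁`
(the relation of eventual equality on `(2^ℕ)^ℕ`) is hyperfinite. -/
theorem stmt3 {X : Type} [MeasurableSpace X] [StandardBorelSpace X]
    (E : X → X → Prop) (hEeq : Equivalence E)
    (hEBorel : MeasurableSet {p : X × X | E p.1 p.2})
    (hEcount : ∀ x : X, {y : X | E x y}.Countable)
    (f : X → (ℕ → ℕ → Bool)) (hf : Measurable f)
    (hred : ∀ x y : X, E x y ↔ ∀ᶠ n in atTop, f x n = f y n) :
    ∃ F : ℕ → X → X → Prop,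
      (∀ n, Equivalence (F n)) ∧
      (∀ n, MeasurableSet {p : X × X | F n p.1 p.2}) ∧
      (∀ n x, {y : X | F n x y}.Finite) ∧
      (∀ n x y, F n x y → F (n + 1) x y) ∧
      (∀ x y, E x y ↔ ∃ n, F n x y) := by
  let g : ℕ → X → ℕ → ℕ → Bool := fun n x m => f x (n + m)
  have hg : ∀ n, Measurable (g n) := fun n =>
    measurable_pi_lambda _ fun m => (measurable_pi_apply (n + m)).comp hf
  have hE : ∀ x y, E x y ↔ ∃ n, g n x = g n y := fun x y => by
    rw [hred, eventually_atTop]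
    refine exists_congr fun n => ⟨fun h => funext fun m => h _ (Nat.le_add_right n m),
      fun h m hm => ?_⟩
    obtain ⟨j, rfl⟩ := Nat.exists_eq_add_of_le hm
    exact congrFun h j
  have hgcount : ∀ n x, {x' | g n x = g n x'}.Countable := fun n x =>
    (hEcount x).mono fun y hy => (hE x y).2 ⟨n, hy⟩
  have hgsucc : ∀ n x y, g n x = g n y → g (n + 1) x = g (n + 1) y := fun n x y h =>
    funext fun m => by simpa [g, add_assoc, add_comm 1] using congrFun h (m + 1)
  obtain ⟨k₀, hk₀, -, hsep₀⟩ := exists_measurable_nat_separating_fibers measurable_id (hg 0)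
    (hgcount 0) fun x y h => congrArg (g 0) h
  choose k hk hinv hsep using fun n => exists_measurable_nat_separating_fibers (hg n) (hg (n + 1))
    (hgcount (n + 1)) (hgsucc n)
  have hgle : ∀ {m n}, m ≤ n → ∀ x y, g m x = g m y → g n x = g n y := fun hmn x y h =>
    Nat.le_induction h (fun n _ ih => hgsucc n x y ih) _ hmn
  let c : ℕ → X → ℕ := fun n => n.casesOn k₀ k
  have hc : ∀ n, Measurable (c n) := fun n => by cases n <;> [exact hk₀; exact hk _]
  have hcinj : ∀ x y, E x y → (∀ n, c n x = c n y) → x = y := by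
    intro x y hxy hcxy
    obtain ⟨n, hn⟩ := (hE x y).1 hxy
    induction n with
    | zero => exact hsep₀ x y hn (hcxy 0)
    | succ n ih => exact ih (hsep n x y hn (hcxy (n + 1)))
  let e : X → ℕ → Prop := fun x i => c i.unpair.1 x = i.unpair.2
  refine ⟨fun n x y => E x y ∧ ∀ i, n ≤ i → (e x i ↔ e y i), fun n => ?_, fun n => ?_,
    fun n x => ?_, fun n x y h => ⟨h.1, fun i hi => h.2 i (by omega)⟩, fun x y => ?_⟩
  · exact ⟨fun x => ⟨hEeq.refl x, fun _ _ => Iff.rfl⟩,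
      fun h => ⟨hEeq.symm h.1, fun i hi => (h.2 i hi).symm⟩,
      fun h h' => ⟨hEeq.trans h.1 h'.1, fun i hi => (h.2 i hi).trans (h'.2 i hi)⟩⟩
  · refine hEBorel.inter (measurableSet_setOfPred.2 (Measurable.forall fun i =>
      Measurable.forall fun _ => ?_))
    have he : Measurable fun x => e x i :=
      measurableSet_setOfPred.1 (measurableSet_eq_fun (hc _) measurable_const)
    exact (he.comp measurable_fst).iff (he.comp measurable_snd)
  · refine Finite.of_finite_image (f := fun y (i : Fin n) => e y i) (toFinite _) ?_
    intro y hy z hz hyz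
    refine hcinj y z (hEeq.trans (hEeq.symm hy.1) hz.1) fun m => ?_
    have hi : e y (Nat.pair m (c m y)) ↔ e z (Nat.pair m (c m y)) := by
      by_cases hlt : Nat.pair m (c m y) < n
      · exact iff_of_eq (congrFun hyz ⟨_, hlt⟩)
      · exact (hy.2 _ (not_lt.1 hlt)).symm.trans (hz.2 _ (not_lt.1 hlt))
    simpa [e, eq_comm] using hi
  · refine ⟨fun hxy => ?_, fun ⟨n, hn⟩ => hn.1⟩
    obtain ⟨N, hN⟩ := (hE x y).1 hxy
    have hfin : {i | ¬(e x i ↔ e y i)}.Finite := by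
      refine ((finite_Iic N).biUnion fun m _ =>
        toFinite {Nat.pair m (c m x), Nat.pair m (c m y)}).subset fun i hi => ?_
      obtain ⟨⟨m, j⟩, rfl⟩ := Nat.pairEquiv.surjective i
      simp only [e, mem_ofPred_eq, Nat.pairEquiv_apply, Function.uncurry, Nat.unpair_pair] at hi
      refine mem_biUnion (x := m) ?_ ?_
      · by_contra hm
        obtain ⟨m, rfl⟩ : ∃ l, m = l + 1 := ⟨m - 1, by simp at hm; omega⟩
        have : c (m + 1) x = c (m + 1) y := hinv m x y (hgle (by simp at hm; omega) x y hN)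
        rw [this] at hi
        exact hi Iff.rfl
      · by_contra hj
        simp only [Nat.pairEquiv_apply, Function.uncurry, mem_insert_iff, mem_singleton_iff,
          Nat.pair_eq_pair, true_and, not_or] at hj
        exact hi (iff_of_false (fun h => hj.1 h.symm) fun h => hj.2 h.symm)
    obtain ⟨n, hn⟩ := hfin.bddAbove
    exact ⟨n + 1, hxy, fun i hi => by_contra fun h => by have := hn h; omega⟩
end

section
/- Let α be a Toeplitz sequence over the alphabet 𝔫, let p ≥ 1, and for 0 ≤ k < p let A(α,p,k) = {σ^i(α) : i ∈ ℕ, i ≡ k (mod p)}. Then every element of the closure of A(α,p,k) has the same p-skeleton as σ^k(α): for every symbol a ∈ 𝔫 and every γ in the closure of A(α,p,k), Per_p(σ^k(α), a) = Per_p(γ, a). -/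
open Filter Topology TopologicalSpace Set

/-- `Per_p(x, a)`: indices at which `x` is `p`-periodically equal to the symbol `a`. -/
def PerSym (A : Type) (p : ℕ) (x : ℤ → A) (a : A) : Set ℤ :=
  {i : ℤ | ∀ k : ℤ, x (i + p * k) = a}

/-- `A(α, p, k) = {σ^i(α) : i ∈ ℕ, i ≡ k (mod p)}`. -/
def Aset (A : Type) (x : ℤ → A) (p k : ℕ) : Set (ℤ → A) :=
  {y | ∃ i : ℕ, i % p = k % p ∧ y = (shiftMap A)^[i] x}

lemma iterate_shiftMap_apply (A : Type) (x : ℤ → A) (n : ℕ) (i : ℤ) :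
    (shiftMap A)^[n] x i = x (i + n) := by
  induction n generalizing i with
  | zero => simp
  | succ n ih =>
    rw [Function.iterate_succ_apply']
    simp only [shiftMap, ih]
    push_cast
    congr 1
    ring

lemma exists_eq_apply_of_mem_Aset {A : Type} {x y : ℤ → A} {p k : ℕ} (hy : y ∈ Aset A x p k) :
    ∃ t : ℤ, ∀ i : ℤ, y i = x (i + k + p * t) := by
  obtain ⟨s, hs, rfl⟩ := hy
  obtain ⟨t, ht⟩ := (Nat.modEq_iff_dvd.mp (Nat.ModEq.symm hs) : (p : ℤ) ∣ s - k)
  refine ⟨t, fun i => ?_⟩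
  rw [iterate_shiftMap_apply, ← ht]
  congr 1
  ring

lemma isClosed_setOf_apply_eq {A : Type} [TopologicalSpace A] [DiscreteTopology A]
    (i : ℤ) (a : A) : IsClosed {y : ℤ → A | y i = a} :=
  isClosed_eq (continuous_apply i) continuous_const

/-- every element of the closure of `A(α,p,k)` has the same `p`-skeleton as
`σ^k(α)`. -/
theorem stmt7 {A : Type} [Fintype A] (h2 : 2 ≤ Fintype.card A)
    [TopologicalSpace A] [DiscreteTopology A]
    (α : ℤ → A) (hα : IsToeplitzSeq A α) (p : ℕ) (hp : 1 ≤ p) (k : ℕ) (hk : k < p)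
    (a : A) (γ : ℤ → A) (hγ : γ ∈ closure (Aset A α p k)) :
    PerSym A p ((shiftMap A)^[k] α) a = PerSym A p γ a := by
  ext i
  simp only [PerSym, mem_ofPred_eq, iterate_shiftMap_apply]
  constructor
  · intro h m
    refine closure_minimal (fun y hy => ?_) (isClosed_setOf_apply_eq (i + p * m) a) hγ
    obtain ⟨t, ht⟩ := exists_eq_apply_of_mem_Aset hy
    rw [mem_ofPred_eq, ht, ← h (m + t)]
    congr 1
    ring
  · intro h m₀
    obtain ⟨j, hj, hper⟩ := hα.2 (i + p * m₀ + k)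
    have hclosed : IsClosed (⋃ m ∈ Finset.range j,
        {y : ℤ → A | y (i + p * m) = α (i + p * m₀ + k)}) :=
      isClosed_biUnion_finset fun m _ => isClosed_setOf_apply_eq _ _
    have hmem := closure_minimal (fun y hy => ?_) hclosed hγ
    · simp only [mem_iUnion, mem_ofPred_eq] at hmem
      obtain ⟨m, -, hm⟩ := hmem
      rw [← hm, h]
    · obtain ⟨t, ht⟩ := exists_eq_apply_of_mem_Aset hy
      have hj' : (0 : ℤ) < j := by exact_mod_cast hj
      obtain ⟨m, hm⟩ := Int.eq_ofNat_of_zero_le (Int.emod_nonneg (m₀ - t) hj'.ne')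
      have hlt := Int.emod_lt_of_pos (m₀ - t) hj'
      have hdiv := Int.emod_add_mul_ediv (m₀ - t) j
      rw [hm] at hlt hdiv
      simp only [mem_iUnion, mem_ofPred_eq, Finset.mem_range]
      refine ⟨m, by exact_mod_cast hlt, ?_⟩
      rw [ht, ← hper (-(p * ((m₀ - t) / j)))]
      congr 1
      linear_combination (p : ℤ) * hdiv
end

section
/- Let α be a Toeplitz sequence over the alphabet 𝔫 and let (r_i) be a factorization of the scale of α, i.e., a sequence of positive integers with r_i | r_{i+1} for all i, such that every r_i divides some essential period of α and every essential period of α divides some r_i. For p ≥ 1 and 0 ≤ k < p let A(α,p,k) = {σ^i(α) : i ∈ ℕ, i ≡ k (mod p)}, and let O be the closure of the σ-orbit of α. Then for every i ∈ ℕ: (a) the sets closure(A(α,r_i,k)) for 0 ≤ k < r_i are pairwise disjoint and their union is O; (b) closure(A(α,r_i,k)) ⊆ closure(A(α,r_j,l)) whenever j < i, 0 ≤ k < r_i, 0 ≤ l < r_j and k ≡ l (mod r_j); (c) σ[closure(A(α,r_i,r_i−1))] = closure(A(α,r_i,0)) and σ[closure(A(α,r_i,k))] = closure(A(α,r_i,k+1))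 for all 0 ≤ k < r_i−1. -/
open Filter Topology TopologicalSpace Set

section ToeplitzShift

variable {A : Type}

lemma shiftMap_iterate_apply (x : ℤ → A) (n : ℕ) (i : ℤ) :
    (shiftMap A)^[n] x i = x (i + n) := by
  induction n generalizing i with
  | zero => simp
  | succ n ih =>
    rw [Function.iterate_succ_apply', shiftMap, ih]
    congr 1
    push_cast
    ring

lemma Per_subset_of_dvd {p q : ℕ} (h : p ∣ q) (x : ℤ → A) : Per A p x ⊆ Per A q x := by
  obtain ⟨c, rfl⟩ := h
  intro i hi k
  have := hi (c * k)
  rwa [← mul_assoc, ← Nat.cast_mul] at this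

lemma add_mul_mem_Per {p : ℕ} {x : ℤ → A} {i : ℤ} (hi : i ∈ Per A p x) (t : ℤ) :
    i + p * t ∈ Per A p x := by
  intro k
  rw [hi t, add_assoc, ← mul_add, hi]

lemma IsToeplitzSeq.exists_mem_Per {x : ℤ → A} (hx : IsToeplitzSeq A x) (i : ℤ) :
    ∃ j : ℕ, 1 ≤ j ∧ i ∈ Per A j x := by
  obtain ⟨j, hj, h⟩ := hx.2 i
  exact ⟨j, hj, fun k => by rw [mul_comm]; exact h k⟩

lemma exists_int_eq_add_mul_of_mod_eq {m n p : ℕ} (h : m % p = n % p) :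
    ∃ t : ℤ, (m : ℤ) = n + p * t := by
  have h' : (n : ℤ) ≡ m [ZMOD p] := Int.natCast_modEq_iff.2 h.symm
  obtain ⟨t, ht⟩ := h'.dvd
  exact ⟨t, by linarith⟩

lemma Aset_subset_of_dvd {p q k l : ℕ} (h : p ∣ q) (hkl : k % p = l % p) (x : ℤ → A) :
    Aset A x q k ⊆ Aset A x p l := by
  rintro y ⟨n, hn, rfl⟩
  refine ⟨n, ?_, rfl⟩
  rw [← hkl]
  exact Nat.ModEq.of_dvd h hn

variable [TopologicalSpace A]

lemma continuous_shiftMap : Continuous (shiftMap A) :=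
  continuous_pi fun i => continuous_apply (i + 1)

lemma exists_mem_closure_Aset_of_dvd {p q k : ℕ} (h : p ∣ q) (hq : 1 ≤ q) {x y : ℤ → A}
    (hy : y ∈ closure (Aset A x p k)) :
    ∃ s < q, s % p = k % p ∧ y ∈ closure (Aset A x q s) := by
  have hsub : Aset A x p k ⊆
      ⋃ s ∈ {s ∈ Finset.range q | s % p = k % p}, Aset A x q s := by
    rintro z ⟨n, hn, rfl⟩
    simp only [mem_iUnion]
    refine ⟨n % q, ?_, n, (Nat.mod_mod _ _).symm, rfl⟩
    rw [Finset.mem_filter, Finset.mem_range, Nat.mod_mod_of_dvd _ h]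
    exact ⟨Nat.mod_lt _ hq, hn⟩
  have := closure_mono hsub hy
  rw [Finset.closure_biUnion] at this
  simp only [mem_iUnion, Finset.mem_filter, Finset.mem_range] at this
  obtain ⟨s, ⟨hs, hk⟩, hy⟩ := this
  exact ⟨s, hs, hk, hy⟩

lemma iUnion_closure_Aset (x : ℤ → A) {p : ℕ} (hp : 1 ≤ p) :
    ⋃ (k : ℕ) (_ : k < p), closure (Aset A x p k) = orbitClosure A x := by
  refine Subset.antisymm (iUnion₂_subset fun k _ => closure_mono ?_) fun y hy => ?_
  · rintro y ⟨n, -, rfl⟩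
    exact ⟨n, rfl⟩
  · have hy' : y ∈ closure (Aset A x 1 0) := by
      refine closure_mono ?_ hy
      rintro z ⟨n, rfl⟩
      exact ⟨n, by simp [Nat.mod_one], rfl⟩
    obtain ⟨s, hs, -, hys⟩ := exists_mem_closure_Aset_of_dvd (one_dvd p) hp hy'
    exact mem_iUnion₂.2 ⟨s, hs, hys⟩

lemma IsToeplitzSeq.mem_closure_iterate {x : ℤ → A} (hx : IsToeplitzSeq A x) (p : ℕ) (hp : 1 ≤ p) :
    x ∈ closure {y | ∃ n : ℕ, n % p = 0 ∧ 1 ≤ n ∧ y = (shiftMap A)^[n] x} := by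
  refine mem_closure_of_tendsto (b := atTop)
    (f := fun N : ℕ => (shiftMap A)^[p * N.factorial] x) ?_
    (Eventually.of_forall fun N => ⟨_, Nat.mul_mod_right _ _,
      Nat.mul_pos hp N.factorial_pos, rfl⟩)
  rw [tendsto_pi_nhds]
  intro i
  obtain ⟨j, hj, hi⟩ := hx.exists_mem_Per i
  refine tendsto_nhds_of_eventually_eq ?_
  filter_upwards [eventually_ge_atTop j] with N hN
  rw [shiftMap_iterate_apply]
  have h := Per_subset_of_dvd ((Nat.dvd_factorial hj hN).mul_left p) x hi 1
  rwa [mul_one] at h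

variable [DiscreteTopology A]

lemma apply_sub_of_mem_closure_Aset {p s : ℕ} {x y : ℤ → A} (hy : y ∈ closure (Aset A x p s))
    {i : ℤ} (hi : i ∈ Per A p x) : y (i - s) = x i := by
  have hcl : IsClosed {z : ℤ → A | z (i - s) = x i} :=
    (isClosed_discrete {x i}).preimage (f := fun z : ℤ → A => z (i - s)) (continuous_apply _)
  refine closure_minimal ?_ hcl hy
  rintro z ⟨n, hn, rfl⟩
  obtain ⟨t, ht⟩ := exists_int_eq_add_mul_of_mod_eq hn
  rw [mem_ofPred_eq, shiftMap_iterate_apply, ht, ← hi t]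
  congr 1
  ring

lemma IsToeplitzSeq.mem_Per_iff_of_mem_closure_Aset {x : ℤ → A} (hx : IsToeplitzSeq A x)
    {p k : ℕ} (hp : 1 ≤ p) {y : ℤ → A} (hy : y ∈ closure (Aset A x p k)) (i : ℤ) :
    i ∈ Per A p y ↔ i + k ∈ Per A p x := by
  constructor
  · intro hi t
    obtain ⟨a, ha, hia⟩ := hx.exists_mem_Per (i + k)
    obtain ⟨b, hb, hib⟩ := hx.exists_mem_Per (i + k + p * t)
    obtain ⟨s, -, hs, hys⟩ := exists_mem_closure_Aset_of_dvd (q := p * (a * b))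
      (dvd_mul_right _ _) (Nat.mul_pos hp (Nat.mul_pos ha hb)) hy
    obtain ⟨u, hu⟩ := exists_int_eq_add_mul_of_mod_eq hs
    have h₁ := apply_sub_of_mem_closure_Aset hys
      (Per_subset_of_dvd ((dvd_mul_right a b).mul_left p) x hia)
    have h₂ := apply_sub_of_mem_closure_Aset hys
      (Per_subset_of_dvd ((dvd_mul_left b a).mul_left p) x hib)
    have e₁ : i + k - s = i + p * (-u) := by rw [hu]; ring
    have e₂ : i + k + p * t - s = i + p * (t - u) := by rw [hu]; ring
    rw [e₁, hi] at h₁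
    rw [e₂, hi] at h₂
    rw [← h₁, ← h₂]
  · intro hi t
    have h₁ := apply_sub_of_mem_closure_Aset hy hi
    have h₂ := apply_sub_of_mem_closure_Aset hy (add_mul_mem_Per hi t)
    have e₁ : i + k - k = i := by ring
    have e₂ : i + k + p * t - k = i + p * t := by ring
    rw [e₁] at h₁
    rw [e₂, hi] at h₂
    rw [h₁, h₂]

lemma IsToeplitzSeq.shift_skeleton {x : ℤ → A} (hx : IsToeplitzSeq A x) {p k l : ℕ} (hp : 1 ≤ p)
    {y : ℤ → A} (hk : y ∈ closure (Aset A x p k)) (hl : y ∈ closure (Aset A x p l)) {j : ℤ}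
    (hj : j ∈ Per A p x) : j + (l - k) ∈ Per A p x ∧ x (j + (l - k)) = x j := by
  have hjl : j + (l - k) ∈ Per A p x := by
    have : j - k ∈ Per A p y := (hx.mem_Per_iff_of_mem_closure_Aset hp hk _).2 (by simpa using hj)
    have := (hx.mem_Per_iff_of_mem_closure_Aset hp hl _).1 this
    convert this using 1
    ring
  refine ⟨hjl, ?_⟩
  rw [← apply_sub_of_mem_closure_Aset hl hjl, ← apply_sub_of_mem_closure_Aset hk hj]
  congr 1
  ring

lemma IsToeplitzSeq.eq_of_mem_closure_Aset {x : ℤ → A} (hx : IsToeplitzSeq A x) {e k l : ℕ}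
    (he : IsEssentialPeriod A x e) (hke : k < e) (hle : l < e)
    {y : ℤ → A} (hk : y ∈ closure (Aset A x e k)) (hl : y ∈ closure (Aset A x e l)) : k = l := by
  have hit : ∀ j ∈ Per A e x, ∀ t : ℤ,
      j + ((l : ℤ) - k) * t ∈ Per A e x ∧ x (j + ((l : ℤ) - k) * t) = x j := by
    intro j hj t
    induction t with
    | zero => simpa using hj
    | succ n ih =>
      have h := hx.shift_skeleton he.1 hk hl ih.1
      rwa [ih.2, add_assoc, show ((l : ℤ) - k) * n + (l - k) = (l - k) * (n + 1) by ring] at h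
    | pred n ih =>
      have h := hx.shift_skeleton he.1 hl hk ih.1
      rwa [ih.2, add_assoc, show ((l : ℤ) - k) * -n + (k - l) = (l - k) * (-n - 1) by ring] at h
  have hge : Int.gcd e ((l : ℤ) - k) ∣ e := Int.natCast_dvd_natCast.1 (Int.gcd_dvd_left _ _)
  have hPer : Per A e x = Per A (Int.gcd e ((l : ℤ) - k)) x := by
    refine Subset.antisymm ?_ (Per_subset_of_dvd hge x)
    intro j hj t
    rw [Int.gcd_eq_gcd_ab]
    have h := hit j hj (Int.gcdB e ((l : ℤ) - k) * t)
    rw [← h.2, ← h.1 (Int.gcdA e ((l : ℤ) - k) * t)]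
    congr 1
    ring
  have hpos : 1 ≤ Int.gcd e ((l : ℤ) - k) := Nat.pos_of_dvd_of_pos hge he.1
  have heq : Int.gcd e ((l : ℤ) - k) = e :=
    (Nat.le_of_dvd he.1 hge).eq_of_not_lt fun hlt => he.2.2 _ hpos hlt hPer
  have hdvd : (e : ℤ) ∣ (l : ℤ) - k := by
    have := Int.gcd_dvd_right (e : ℤ) ((l : ℤ) - k)
    rwa [heq] at this
  have := Int.eq_zero_of_abs_lt_dvd hdvd (by rw [abs_lt]; omega)
  omega

lemma IsToeplitzSeq.disjoint_closure_Aset {x : ℤ → A} (hx : IsToeplitzSeq A x) {p e k l : ℕ}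
    (he : IsEssentialPeriod A x e) (hpe : p ∣ e) (hk : k < p) (hl : l < p) (hkl : k ≠ l) :
    Disjoint (closure (Aset A x p k)) (closure (Aset A x p l)) := by
  rw [Set.disjoint_left]
  intro y hyk hyl
  obtain ⟨s, hs, hsk, hys⟩ := exists_mem_closure_Aset_of_dvd hpe he.1 hyk
  obtain ⟨t, ht, htl, hyt⟩ := exists_mem_closure_Aset_of_dvd hpe he.1 hyl
  have hst := hx.eq_of_mem_closure_Aset he hs ht hys hyt
  rw [Nat.mod_eq_of_lt hk] at hsk
  rw [Nat.mod_eq_of_lt hl] at htl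
  exact hkl (by rw [← hsk, ← htl, hst])

lemma IsToeplitzSeq.shiftMap_image_closure_Aset [Finite A] {x : ℤ → A} (hx : IsToeplitzSeq A x)
    {p : ℕ} (hp : 1 ≤ p) (k : ℕ) :
    shiftMap A '' closure (Aset A x p k) = closure (Aset A x p (k + 1)) := by
  rw [← continuous_shiftMap.isClosedMap.closure_image_eq_of_continuous continuous_shiftMap]
  have hsucc : ∀ n : ℕ, (n + 1) % p = (k + 1) % p →
      (shiftMap A)^[n + 1] x ∈ shiftMap A '' Aset A x p k := fun n hn =>
    ⟨(shiftMap A)^[n] x, ⟨n, Nat.ModEq.add_right_cancel' 1 hn, rfl⟩,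
      (Function.iterate_succ_apply' _ _ _).symm⟩
  refine Subset.antisymm (closure_mono ?_) (closure_minimal ?_ isClosed_closure)
  · rintro _ ⟨_, ⟨n, hn, rfl⟩, rfl⟩
    exact ⟨n + 1, Nat.ModEq.add_right 1 hn, (Function.iterate_succ_apply' _ _ _).symm⟩
  · rintro _ ⟨n, hn, rfl⟩
    cases n with
    | succ n => exact subset_closure (hsucc n hn)
    | zero =>
      refine closure_mono ?_ (hx.mem_closure_iterate p hp)
      rintro _ ⟨m, hm, hm1, rfl⟩
      obtain ⟨m, rfl⟩ := Nat.exists_eq_add_of_le' hm1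
      exact hsucc m (by rw [hm, ← hn, Nat.zero_mod])

end ToeplitzShift

/-- for a factorization `(r_i)` of the scale of a Toeplitz sequence `α`:
(a) the closures of the `A(α, r_i, k)`, `0 ≤ k < r_i`, partition the orbit closure of `α`;
(b) they refine the partitions at earlier stages; (c) the shift permutes them cyclically. -/
theorem stmt8 {A : Type} [Fintype A] (h2 : 2 ≤ Fintype.card A)
    [TopologicalSpace A] [DiscreteTopology A]
    (α : ℤ → A) (hα : IsToeplitzSeq A α)
    (r : ℕ → ℕ) (hr1 : ∀ i, 1 ≤ r i) (hrdvd : ∀ i, r i ∣ r (i + 1))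
    (hrper : ∀ i, ∃ e : ℕ, IsEssentialPeriod A α e ∧ r i ∣ e)
    (hrall : ∀ e : ℕ, IsEssentialPeriod A α e → ∃ i, e ∣ r i) :
    ∀ i : ℕ,
      -- (a) pairwise disjoint with union the orbit closure
      ((∀ k l : ℕ, k < r i → l < r i → k ≠ l →
          Disjoint (closure (Aset A α (r i) k)) (closure (Aset A α (r i) l))) ∧
        (⋃ (k : ℕ) (_ : k < r i), closure (Aset A α (r i) k)) = orbitClosure A α) ∧
      -- (b) refinement
      (∀ j k l : ℕ, j < i → k < r i → l < r j → k % r j = l % r j →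
        closure (Aset A α (r i) k) ⊆ closure (Aset A α (r j) l)) ∧
      -- (c) the shift acts cyclically
      (shiftMap A '' closure (Aset A α (r i) (r i - 1)) = closure (Aset A α (r i) 0) ∧
        ∀ k : ℕ, k + 1 < r i →
          shiftMap A '' closure (Aset A α (r i) k) = closure (Aset A α (r i) (k + 1))) := by
  intro i
  have hwrap : Aset A α (r i) (r i - 1 + 1) = Aset A α (r i) 0 := by
    simp only [Aset, Nat.sub_add_cancel (hr1 i), Nat.mod_self, Nat.zero_mod]
  refine ⟨⟨?_, iUnion_closure_Aset α (hr1 i)⟩, ?_, ?_, ?_⟩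
  · obtain ⟨e, he, hie⟩ := hrper i
    intro k l hk hl hkl
    exact hα.disjoint_closure_Aset he hie hk hl hkl
  · intro j k l hj _ _ hkl
    exact closure_mono (Aset_subset_of_dvd (Nat.rel_of_forall_rel_succ_of_le (· ∣ ·) hrdvd hj.le)
      hkl α)
  · rw [hα.shiftMap_image_closure_Aset (hr1 i), hwrap]
  · intro k _
    exact hα.shiftMap_image_closure_Aset (hr1 i) k
end

section
/- Let E ⊆ F be countable Borel equivalence relations on a standard Borel space X such that F is a finite index extension of E, i.e., every F-class is the union of finitely many E-classes. Then F is Borel reducible to E^fin. -/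
open TopologicalSpace

/-- The Borel σ-algebra on the hyperspace `K(X)` of nonempty compact subsets of a metric
space `X`, with the topology induced by the Hausdorff metric. -/
noncomputable instance (X : Type) [MetricSpace X] :
    MeasurableSpace (NonemptyCompacts X) := borel _

instance (X : Type) [MetricSpace X] : BorelSpace (NonemptyCompacts X) := ⟨rfl⟩

/-- `Fin(X)`: the nonempty finite subsets of `X`, as a subspace of `K(X)`. -/
abbrev FinSubsets (X : Type) [MetricSpace X] : Type :=
  {K : NonemptyCompacts X // (K : Set X).Finite}

/-- The relation `E^fin` on `Fin(X)`: `u E^fin v` iff `u` and `v` meet exactly the same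
`E`-classes. -/
def EFin {X : Type} [MetricSpace X] (E : X → X → Prop) (u v : FinSubsets X) : Prop :=
  (∀ x ∈ (u.1 : Set X), ∃ y ∈ (v.1 : Set X), E x y) ∧
  (∀ y ∈ (v.1 : Set X), ∃ x ∈ (u.1 : Set X), E x y)

open Set Filter Topology MeasureTheory

/-- An analytic set on which `π` is injective is contained in a Borel set on which `π` is
injective. -/
theorem MeasureTheory.AnalyticSet.exists_measurableSet_injOn_superset {Z X : Type*}
    [TopologicalSpace Z] [PolishSpace Z] [MeasurableSpace Z] [BorelSpace Z] [MeasurableSpace X]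
    [MeasurableEq X] {π : Z → X} (hπ : Measurable π) {A : Set Z} (hA : AnalyticSet A)
    (hinj : InjOn π A) : ∃ B, MeasurableSet B ∧ A ⊆ B ∧ InjOn π B := by
  let N (T : Set Z) : Set Z := {z | ∃ a ∈ T, π a = π z ∧ a ≠ z}
  have hN {T : Set Z} (hT : AnalyticSet T) : AnalyticSet (N T) := by
    have hm : MeasurableSet {p : Z × Z | π p.1 = π p.2 ∧ p.1 ≠ p.2} :=
      (measurableSet_eq_fun (hπ.comp measurable_fst) (hπ.comp measurable_snd)).inter
        (measurableSet_eq_fun measurable_fst measurable_snd).compl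
    have hTm : AnalyticSet (Prod.fst ⁻¹' T ∩ {p : Z × Z | π p.1 = π p.2 ∧ p.1 ≠ p.2}) := by
      rw [inter_eq_iInter]
      exact .iInter (Bool.forall_bool.2 ⟨hm.analyticSet, hT.preimage continuous_fst⟩)
    convert hTm.image_of_continuous continuous_snd
    ext z
    simp [N]
  obtain ⟨C, hAC, hNC, hC⟩ := hA.measurablySeparable (hN hA) <| by
    rw [disjoint_left]
    rintro z hz ⟨a, ha, haz, hne⟩
    exact hne (hinj ha hz haz)
  obtain ⟨D, hAD, hND, hD⟩ := hA.measurablySeparable (hN hC.analyticSet) <| by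
    rw [disjoint_left]
    rintro z hz ⟨c, hc, hcz, hne⟩
    exact disjoint_left.1 hNC ⟨z, hz, hcz.symm, hne.symm⟩ hc
  refine ⟨C ∩ D, hC.inter hD, subset_inter hAC hAD, fun b hb b' hb' h ↦ ?_⟩
  by_contra hne
  exact disjoint_left.1 hND ⟨b, hb.1, h, hne⟩ hb'.2

/-- The family `U` cannot be prevented from meeting a common fiber of `π` by removing countably
many Borel sets on which `π` is injective. -/
def MeetsCommonFiber {ι Z X : Type*} [MeasurableSpace Z] (π : Z → X) (U : ι → Set Z) : Prop :=
  ∀ 𝓑 : Set (Set Z), 𝓑.Countable → (∀ B ∈ 𝓑, MeasurableSet B ∧ InjOn π B) →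
    ∃ z : ι → Z, (∀ i, z i ∈ U i \ ⋃₀ 𝓑) ∧ ∀ i j, π (z i) = π (z j)

theorem MeetsCommonFiber.exists_split {Z X : Type*} [MetricSpace Z] [CompleteSpace Z]
    [SecondCountableTopology Z] [MeasurableSpace Z] [BorelSpace Z] [MeasurableSpace X]
    [MeasurableEq X] {π : Z → X} (hπ : Measurable π) {n : ℕ} {U : Fin (n + 1) → Set Z}
    (hU : ∀ i, IsOpen (U i)) (h : MeetsCommonFiber π U) (j : Fin (n + 1)) {ε : ℝ} (hε : 0 < ε) :
    ∃ U' : Fin (n + 2) → Set Z, (∀ i, IsOpen (U' i)) ∧ MeetsCommonFiber π U' ∧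
      (∀ i : Fin (n + 1), U' i.castSucc ⊆ U i) ∧ U' (Fin.last _) ⊆ U j ∧
      (∀ i, ∀ x ∈ closure (U' i), ∀ y ∈ closure (U' i), dist x y ≤ ε) ∧
      Disjoint (closure (U' j.castSucc)) (closure (U' (Fin.last _))) := by
  by_contra! hcon
  let Candidate := {c : Fin (n + 2) → TopologicalSpace.countableBasis Z //
    (∀ i : Fin (n + 1), (c i.castSucc : Set Z) ⊆ U i) ∧ (c (Fin.last _) : Set Z) ⊆ U j ∧
    (∀ i, ∀ x ∈ closure (c i : Set Z), ∀ y ∈ closure (c i : Set Z), dist x y ≤ ε) ∧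
    Disjoint (closure (c j.castSucc : Set Z)) (closure (c (Fin.last _) : Set Z))}
  have : Countable (TopologicalSpace.countableBasis Z) :=
    (TopologicalSpace.countable_countableBasis Z).to_subtype
  have hbad (c : Candidate) : ¬ MeetsCommonFiber π (fun i ↦ (c.1 i : Set Z)) := fun hc ↦
    hcon _ (fun i ↦ TopologicalSpace.isOpen_of_mem_countableBasis (c.1 i).2) hc c.2.1 c.2.2.1
      c.2.2.2.1 c.2.2.2.2
  unfold MeetsCommonFiber at hbad
  push Not at hbad
  choose 𝓑 h𝓑c h𝓑 hno using hbad
  have hc𝓑 : (⋃ c, 𝓑 c).Countable := countable_iUnion h𝓑c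
  have hm𝓑 : ∀ B ∈ ⋃ c, 𝓑 c, MeasurableSet B ∧ InjOn π B := by
    simp only [mem_iUnion]
    rintro B ⟨c, hc⟩
    exact h𝓑 c B hc
  let S : Set (Fin (n + 1) → Z) :=
    {z | (∀ i, z i ∈ U i \ ⋃₀ ⋃ c, 𝓑 c) ∧ ∀ i j, π (z i) = π (z j)}
  have hS : MeasurableSet S := by
    have hm : MeasurableSet (⋃₀ ⋃ c, 𝓑 c) := .sUnion hc𝓑 fun B hB ↦ (hm𝓑 B hB).1
    simp only [S, ofPred_and, ofPred_forall]
    exact .inter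
      (.iInter fun i ↦ measurable_pi_apply i ((hU i).measurableSet.diff hm))
      (.iInter fun i ↦ .iInter fun j ↦ measurableSet_eq_fun
        (hπ.comp (measurable_pi_apply i)) (hπ.comp (measurable_pi_apply j)))
  have hinj : InjOn π ((fun z : Fin (n + 1) → Z ↦ z j) '' S) := by
    rintro _ ⟨z, hz, rfl⟩ _ ⟨z', hz', rfl⟩ (hzz' : π (z j) = π (z' j))
    by_contra (hne : z j ≠ z' j)
    let w : Fin (n + 2) → Z := Fin.snoc z (z' j)
    let U₀ : Fin (n + 2) → Set Z := Fin.snoc U (U j)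
    have hw (i) : w i ∈ U₀ i \ ⋃₀ ⋃ c, 𝓑 c := by
      refine Fin.lastCases ?_ (fun i ↦ ?_) i
      · simpa [w, U₀] using hz'.1 j
      · simpa [w, U₀] using hz.1 i
    have hU₀ (i) : IsOpen (U₀ i) := by
      refine Fin.lastCases ?_ (fun i ↦ ?_) i
      · simpa [U₀] using hU j
      · simpa [U₀] using hU i
    have hπw (i) : π (w i) = π (z j) := by
      refine Fin.lastCases ?_ (fun i ↦ ?_) i
      · simpa [w] using hzz'.symm
      · simpa [w] using hz.2 i j
    have hd : 0 < dist (z j) (z' j) := dist_pos.2 hne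
    obtain ⟨δ, hδ, hδε, hδd⟩ : ∃ δ > 0, δ + δ ≤ ε ∧ δ + δ < dist (z j) (z' j) :=
      ⟨min (ε / 2) (dist (z j) (z' j) / 3), by positivity, by
        linarith [min_le_left (ε / 2) (dist (z j) (z' j) / 3)], by
        linarith [min_le_right (ε / 2) (dist (z j) (z' j) / 3)]⟩
    have hnhd (i) : ∃ V ∈ TopologicalSpace.countableBasis Z,
        w i ∈ V ∧ V ⊆ U₀ i ∩ Metric.ball (w i) δ :=
      (TopologicalSpace.isBasis_countableBasis Z).exists_subset_of_mem_open
        ⟨(hw i).1, Metric.mem_ball_self hδ⟩ ((hU₀ i).inter Metric.isOpen_ball)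
    choose V hV hwV hVU using hnhd
    have hcl (i) : closure (V i) ⊆ Metric.closedBall (w i) δ :=
      (closure_mono ((hVU i).trans inter_subset_right)).trans Metric.closure_ball_subset_closedBall
    let c : Candidate := ⟨fun i ↦ ⟨V i, hV i⟩,
      fun i ↦ by simpa [U₀] using (hVU i.castSucc).trans inter_subset_left,
      by simpa [U₀] using (hVU (Fin.last _)).trans inter_subset_left,
      fun i x hx y hy ↦ (dist_triangle_right x y (w i)).trans
        ((add_le_add (hcl i hx) (hcl i hy)).trans hδε),
      (Metric.closedBall_disjoint_closedBall (by simpa [w] using hδd)).mono (hcl _) (hcl _)⟩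
    obtain ⟨i, i', hii'⟩ := hno c w fun i ↦
      ⟨hwV i, fun hi ↦ (hw i).2 (sUnion_mono (subset_iUnion 𝓑 c) hi)⟩
    exact hii' ((hπw i).trans (hπw i').symm)
  obtain ⟨B, hB, hSB, hBinj⟩ :=
    (hS.analyticSet_image (measurable_pi_apply j)).exists_measurableSet_injOn_superset hπ hinj
  obtain ⟨z, hz, hπz⟩ := h (insert B (⋃ c, 𝓑 c)) (hc𝓑.insert B)
    (forall_mem_insert.2 ⟨⟨hB, hBinj⟩, hm𝓑⟩)
  refine (hz j).2 ⟨B, mem_insert _ _, hSB ⟨z, ⟨fun i ↦ ⟨(hz i).1, fun hi ↦ (hz i).2 ?_⟩, hπz⟩, rfl⟩⟩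
  exact sUnion_mono (subset_insert _ _) hi

/-- A countable-to-one continuous map on a Polish space is injective on each piece of a countable
Borel cover. -/
theorem Continuous.exists_countable_measurableSet_injOn {Z X : Type*} [MetricSpace Z]
    [CompleteSpace Z] [SecondCountableTopology Z] [MeasurableSpace Z] [BorelSpace Z]
    [TopologicalSpace X] [T2Space X] [MeasurableSpace X] [BorelSpace X] [MeasurableEq X]
    {π : Z → X} (hπ : Continuous π) (hfib : ∀ x, (π ⁻¹' {x}).Countable) :
    ∃ 𝓑 : Set (Set Z), 𝓑.Countable ∧ (∀ B ∈ 𝓑, MeasurableSet B ∧ InjOn π B) ∧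
      ⋃₀ 𝓑 = univ := by
  by_contra! hcon
  let State (n : ℕ) := {U : Fin (n + 1) → Set Z // (∀ i, IsOpen (U i)) ∧ MeetsCommonFiber π U}
  let s₀ : State 0 := ⟨fun _ ↦ univ, fun _ ↦ isOpen_univ, fun 𝓑 hc h𝓑 ↦ by
    obtain ⟨z, hz⟩ := (ne_univ_iff_exists_notMem _).1 (hcon 𝓑 hc h𝓑)
    exact ⟨fun _ ↦ z, fun _ ↦ ⟨mem_univ _, hz⟩, fun _ _ ↦ rfl⟩⟩
  let j (n : ℕ) : Fin (n + 1) := ⟨n.unpair.1, Nat.lt_succ_of_le n.unpair_left_le⟩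
  have hstep (n : ℕ) (U : State n) : ∃ U' : State (n + 1),
      (∀ i : Fin (n + 1), U'.1 i.castSucc ⊆ U.1 i) ∧ U'.1 (Fin.last _) ⊆ U.1 (j n) ∧
      (∀ i, ∀ x ∈ closure (U'.1 i), ∀ y ∈ closure (U'.1 i), dist x y ≤ (1 / 2 : ℝ) ^ n) ∧
      Disjoint (closure (U'.1 (j n).castSucc)) (closure (U'.1 (Fin.last _))) := by
    obtain ⟨U', hU', hmeet, h⟩ := U.2.2.exists_split hπ.measurable U.2.1 (j n)
      (ε := (1 / 2 : ℝ) ^ n) (by positivity)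
    exact ⟨⟨U', hU', hmeet⟩, h⟩
  choose next hnext hnextj hdist hdisj using hstep
  let u (n : ℕ) : State n := Nat.rec s₀ next n
  let V (n i : ℕ) : Set Z := if h : i < n + 1 then (u n).1 ⟨i, h⟩ else univ
  have hV {n i : ℕ} (h : i < n + 1) : V n i = (u n).1 ⟨i, h⟩ := dif_pos h
  have hVmono {n i : ℕ} (h : i < n + 1) : V (n + 1) i ⊆ V n i := by
    rw [hV h, hV (h.trans (Nat.lt_succ_self _))]
    exact hnext n (u n) ⟨i, h⟩
  have hVj (n : ℕ) : V (n + 1) (n + 1) ⊆ V n n.unpair.1 := by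
    rw [hV (Nat.lt_succ_self _), hV (j n).2]
    exact hnextj n (u n)
  have hVdist {n i : ℕ} (h : i < n + 2) {x y : Z} (hx : x ∈ closure (V (n + 1) i))
      (hy : y ∈ closure (V (n + 1) i)) : dist x y ≤ (1 / 2 : ℝ) ^ n := by
    rw [hV h] at hx hy
    exact hdist n (u n) ⟨i, h⟩ x hx y hy
  have hVdisj (n : ℕ) :
      Disjoint (closure (V (n + 1) n.unpair.1)) (closure (V (n + 1) (n + 1))) := by
    rw [hV (Nat.lt_succ_self _), hV ((j n).2.trans (Nat.lt_succ_self _))]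
    exact hdisj n (u n)
  have hc (n : ℕ) : ∃ c : ℕ → Z, (∀ i < n + 1, c i ∈ V n i) ∧
      ∀ i < n + 1, ∀ i' < n + 1, π (c i) = π (c i') := by
    obtain ⟨z, hz, hπz⟩ := (u n).2.2 ∅ countable_empty (by simp)
    refine ⟨fun i ↦ if h : i < n + 1 then z ⟨i, h⟩ else z 0, fun i hi ↦ ?_, fun i hi i' hi' ↦ ?_⟩
    · simpa [hV hi, hi] using (hz ⟨i, hi⟩).1
    · simpa [hi, hi'] using hπz _ _
  choose c hcV hcπ using hc
  have hVanti {i n m : ℕ} (hin : i < n + 1) (hnm : n ≤ m) : V m i ⊆ V n i := by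
    induction m, hnm using Nat.le_induction with
    | base => rfl
    | succ m hm ih => exact (hVmono (by lia)).trans ih
  have hlim (i : ℕ) : ∃ z, Tendsto (fun n ↦ c n i) atTop (𝓝 z) := by
    refine cauchySeq_tendsto_of_complete (Metric.cauchySeq_iff'.2 fun ε hε ↦ ?_)
    obtain ⟨N, hN⟩ := exists_pow_lt_of_lt_one hε (by norm_num : (1 / 2 : ℝ) < 1)
    refine ⟨N + i + 1, fun n hn ↦ (hVdist (n := N + i) (i := i) (by lia)
      (subset_closure (hVanti (by lia) hn (hcV n i (by lia))))
      (subset_closure (hcV _ i (by lia)))).trans_lt (lt_of_le_of_lt ?_ hN)⟩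
    exact pow_le_pow_of_le_one (by norm_num) (by norm_num) (by lia)
  choose z hz using hlim
  have hzV {n i : ℕ} (h : i < n + 1) : z i ∈ closure (V n i) :=
    mem_closure_of_tendsto (hz i) <| (eventually_ge_atTop n).mono fun m hm ↦
      hVanti h hm (hcV m i (by lia))
  have hπz (i : ℕ) : π (z i) = π (z 0) :=
    tendsto_nhds_unique_of_eventuallyEq ((hπ.tendsto _).comp (hz i)) ((hπ.tendsto _).comp (hz 0)) <|
      (eventually_ge_atTop i).mono fun m hm ↦ hcπ m i (by lia) 0 (by lia)
  have hpre : Preperfect (range z) := by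
    rw [preperfect_iff_nhds]
    rintro _ ⟨i, rfl⟩ O hO
    obtain ⟨ε, hε, hball⟩ := Metric.mem_nhds_iff.1 hO
    obtain ⟨N, hN⟩ := exists_pow_lt_of_lt_one hε (by norm_num : (1 / 2 : ℝ) < 1)
    obtain ⟨m, hm⟩ : ∃ m, Nat.pair i (N + 1) = m + 1 :=
      Nat.exists_eq_succ_of_ne_zero (by have := Nat.right_le_pair i (N + 1); lia)
    have hNm : N ≤ m := by have := Nat.right_le_pair i (N + 1); lia
    have him : i < m + 2 := by have := Nat.left_le_pair i (N + 1); lia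
    have hj : (m + 1).unpair.1 = i := by rw [← hm, Nat.unpair_pair]
    have hVj' := hVj (m + 1)
    have hVdisj' := hVdisj (m + 1)
    rw [hj] at hVj' hVdisj'
    have hzm : z (m + 2) ∈ closure (V (m + 2) (m + 2)) := hzV (Nat.lt_succ_self _)
    refine ⟨z (m + 2), ⟨hball ?_, mem_range_self _⟩, fun he ↦ ?_⟩
    · refine (hVdist him (closure_mono hVj' hzm) (hzV him)).trans_lt (lt_of_le_of_lt ?_ hN)
      exact pow_le_pow_of_le_one (by norm_num) (by norm_num) hNm
    · exact disjoint_left.1 hVdisj' (hzV (by lia)) (he ▸ hzm)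
  obtain ⟨f, hf, -, hfinj⟩ :=
    hpre.perfect_closure.exists_nat_bool_injection (range_nonempty z).closure
  have hsub : closure (range z) ⊆ π ⁻¹' {π (z 0)} :=
    closure_minimal (range_subset_iff.2 hπz) (isClosed_singleton.preimage hπ)
  have hcount : Countable (range f) := ((hfib _).mono (hf.trans hsub)).to_subtype
  have : Countable (ℕ → Bool) := (rangeFactorization_injective.2 hfinj).countable
  refine (Cardinal.cantor Cardinal.aleph0).not_ge ?_
  rw [← Cardinal.mk_bool, ← Cardinal.mk_nat, Cardinal.power_def, Cardinal.mk_nat]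
  exact Cardinal.mk_le_aleph0_iff.2 this

/-- **Lusin–Novikov**: a Borel relation with countable sections that contains the diagonal is
covered by the graphs of countably many Borel functions which it contains. -/
theorem exists_measurable_seq_of_countable_sections {X : Type*} [TopologicalSpace X]
    [PolishSpace X] [MeasurableSpace X] [BorelSpace X] {F : X → X → Prop} (hrefl : ∀ x, F x x)
    (hF : MeasurableSet {p : X × X | F p.1 p.2}) (hcount : ∀ x, {y | F x y}.Countable) :
    ∃ f : ℕ → X → X, (∀ n, Measurable (f n)) ∧ ∀ x y, F x y ↔ ∃ n, f n x = y := by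
  let Z := {p : X × X | F p.1 p.2}
  have : StandardBorelSpace Z := hF.standardBorel
  have hfst : Measurable fun z : Z ↦ z.1.1 := measurable_fst.comp measurable_subtype_coe
  have hsnd : Measurable fun z : Z ↦ z.1.2 := measurable_snd.comp measurable_subtype_coe
  have hfib (x : X) : ((fun z : Z ↦ z.1.1) ⁻¹' {x}).Countable := by
    refine MapsTo.countable_of_injOn (f := fun z : Z ↦ z.1.2) (t := {y | F x y}) ?_ ?_ (hcount x)
    · rintro z rfl
      exact z.2
    · rintro z rfl z' hz' h
      exact Subtype.ext (Prod.ext (Eq.symm hz') h)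
  obtain ⟨𝓑, h𝓑c, h𝓑, hcover⟩ : ∃ 𝓑 : Set (Set Z), 𝓑.Countable ∧
      (∀ B ∈ 𝓑, MeasurableSet B ∧ InjOn (fun z : Z ↦ z.1.1) B) ∧ ⋃₀ 𝓑 = univ := by
    obtain ⟨t, hb, hp⟩ := StandardBorelSpace.polish (α := Z)
    obtain ⟨t', ht', hcont, hp'⟩ := hfst.exists_continuous
    have hb' : @BorelSpace Z t' _ := ⟨hb.measurable_eq.trans (borel_eq_borel_of_le hp' hp ht').symm⟩
    clear hb hp ht'
    let := TopologicalSpace.upgradeIsCompletelyMetrizable Z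
    exact hcont.exists_countable_measurableSet_injOn hfib
  obtain ⟨B, hB⟩ := (h𝓑c.insert ∅).exists_eq_range (insert_nonempty _ _)
  have hBn (n : ℕ) : MeasurableSet (B n) ∧ InjOn (fun z : Z ↦ z.1.1) (B n) := by
    have hn : B n ∈ insert ∅ 𝓑 := hB ▸ mem_range_self n
    rcases hn with hn | hn
    · simp [hn]
    · exact h𝓑 _ hn
  classical
  let f (n : ℕ) (x : X) : X := if h : ∃ z ∈ B n, z.1.1 = x then h.choose.1.2 else x
  have hf_mem {n : ℕ} {z : Z} (hz : z ∈ B n) : f n z.1.1 = z.1.2 := by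
    have h : ∃ z' ∈ B n, z'.1.1 = z.1.1 := ⟨z, hz, rfl⟩
    rw [show f n z.1.1 = h.choose.1.2 from dif_pos h,
      (hBn n).2 h.choose_spec.1 hz h.choose_spec.2]
  have hf_notMem {n : ℕ} {x : X} (hx : x ∉ (fun z : Z ↦ z.1.1) '' B n) : f n x = x := dif_neg hx
  refine ⟨f, fun n s hs ↦ ?_, fun x y ↦ ⟨fun hxy ↦ ?_, ?_⟩⟩
  · have himage {T : Set Z} (hT : MeasurableSet T) (hTB : T ⊆ B n) :
        MeasurableSet ((fun z : Z ↦ z.1.1) '' T) :=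
      hT.image_of_measurable_injOn hfst ((hBn n).2.mono hTB)
    convert (himage ((hBn n).1.inter (hsnd hs)) inter_subset_left).union
      (hs.diff (himage (hBn n).1 subset_rfl)) using 1
    ext x
    by_cases hx : x ∈ (fun z : Z ↦ z.1.1) '' B n
    · have hx' := hx
      obtain ⟨z, hz, rfl⟩ := hx'
      simp only [mem_preimage, hf_mem hz, mem_union, Set.mem_sdiff, hx, not_true_eq_false, and_false,
        or_false]
      refine ⟨fun h ↦ ⟨z, ⟨hz, h⟩, rfl⟩, ?_⟩
      rintro ⟨z', ⟨hz', h⟩, he⟩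
      exact (hBn n).2 hz' hz he ▸ h
    · simp only [mem_preimage, hf_notMem hx, mem_union, Set.mem_sdiff, hx, not_false_eq_true, and_true]
      exact ⟨Or.inr, fun h ↦ h.resolve_left fun h ↦ hx (image_mono inter_subset_left h)⟩
  · obtain ⟨T, hT, hxT⟩ : (⟨(x, y), hxy⟩ : Z) ∈ ⋃₀ 𝓑 := hcover ▸ mem_univ _
    obtain ⟨n, rfl⟩ : T ∈ range B := hB ▸ mem_insert_of_mem _ hT
    exact ⟨n, hf_mem hxT⟩
  · rintro ⟨n, rfl⟩
    by_cases hx : x ∈ (fun z : Z ↦ z.1.1) '' B n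
    · obtain ⟨z, hz, rfl⟩ := hx
      rw [hf_mem hz]
      exact z.2
    · rw [hf_notMem hx]
      exact hrefl x

/-- A pointwise finite nonempty union of points, each present on a Borel set of parameters, depends
on the parameter in a Borel way. -/
theorem exists_measurable_finSubsets {X Y : Type} [MetricSpace X] [SecondCountableTopology X]
    [MeasurableSpace X] [BorelSpace X] [MeasurableSpace Y] {f : ℕ → Y → X}
    (hf : ∀ n, Measurable (f n)) {T : ℕ → Set Y} (hT : ∀ n, MeasurableSet (T n))
    (hT₀ : T 0 = univ) (hfin : ∀ y, {n | y ∈ T n}.Finite) :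
    ∃ u : Y → FinSubsets X, Measurable u ∧
      ∀ y, ((u y).1 : Set X) = (fun n ↦ f n y) '' {n | y ∈ T n} := by
  classical
  obtain ⟨g, hg_zero, hg_succ⟩ : ∃ g : ℕ → Y → NonemptyCompacts X, (∀ y, g 0 y = {f 0 y}) ∧
      ∀ k y, g (k + 1) y = if y ∈ T (k + 1) then g k y ⊔ {f (k + 1) y} else g k y :=
    ⟨fun k y ↦ Nat.rec {f 0 y} (fun n K ↦ if y ∈ T (n + 1) then K ⊔ {f (n + 1) y} else K) k,
      fun _ ↦ rfl, fun _ _ ↦ rfl⟩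
  have hsing (n : ℕ) : Measurable fun y ↦ ({f n y} : NonemptyCompacts X) :=
    NonemptyCompacts.continuous_singleton.measurable.comp (hf n)
  have hg (k : ℕ) : Measurable (g k) := by
    induction k with
    | zero => exact funext hg_zero ▸ hsing 0
    | succ k ih =>
      exact funext (hg_succ k) ▸ Measurable.ite (hT (k + 1)) (ih.sup (hsing (k + 1))) ih
  have hg_coe (k : ℕ) (y : Y) :
      (g k y : Set X) = (fun n ↦ f n y) '' {n | n ≤ k ∧ y ∈ T n} := by
    induction k with
    | zero =>
      have : {n | n ≤ 0 ∧ y ∈ T n} = {0} := by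
        ext n
        simp only [mem_ofPred_eq, mem_singleton_iff, Nat.le_zero]
        exact ⟨And.left, by rintro rfl; simp [hT₀]⟩
      rw [this, image_singleton, hg_zero]
      rfl
    | succ k ih =>
      rw [hg_succ]
      split_ifs with h
      · have : {n | n ≤ k + 1 ∧ y ∈ T n} = {n | n ≤ k ∧ y ∈ T n} ∪ {k + 1} := by
          ext n
          grind
        rw [this, image_union, image_singleton, ← ih]
        rfl
      · have : {n | n ≤ k + 1 ∧ y ∈ T n} = {n | n ≤ k ∧ y ∈ T n} := by
          ext n
          grind
        rw [this, ih]
  choose N hN using fun y ↦ (hfin y).bddAbove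
  have hlim (y : Y) {k : ℕ} (hk : N y ≤ k) :
      (g k y : Set X) = (fun n ↦ f n y) '' {n | y ∈ T n} := by
    rw [hg_coe]
    congr 1
    ext n
    exact ⟨And.right, fun h ↦ ⟨(hN y h).trans hk, h⟩⟩
  have hmeas : Measurable fun y ↦ g (N y) y := by
    refine measurable_of_tendsto_metrizable hg (tendsto_pi_nhds.2 fun y ↦ ?_)
    refine tendsto_const_nhds.congr' ((eventually_ge_atTop (N y)).mono fun k hk ↦ ?_)
    exact SetLike.coe_injective ((hlim y le_rfl).trans (hlim y hk).symm)
  exact ⟨fun y ↦ ⟨g (N y) y, hlim y le_rfl ▸ (hfin y).image _⟩, hmeas.subtype_mk,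
    fun y ↦ hlim y le_rfl⟩

/-- if `E ⊆ F` are countable Borel equivalence relations on a Polish space `X`
and `F` is a finite index extension of `E`, then `F` is Borel reducible to `E^fin`. -/
theorem stmt9 {X : Type} [MetricSpace X] [SecondCountableTopology X] [CompleteSpace X]
    [MeasurableSpace X] [BorelSpace X]
    (E F : X → X → Prop) (hEeq : Equivalence E) (hFeq : Equivalence F)
    (hEBorel : MeasurableSet {p : X × X | E p.1 p.2})
    (hFBorel : MeasurableSet {p : X × X | F p.1 p.2})
    (hEcount : ∀ x : X, {y : X | E x y}.Countable)
    (hFcount : ∀ x : X, {y : X | F x y}.Countable)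
    (hsub : ∀ x y, E x y → F x y)
    (hfinindex : ∀ x : X, ∃ s : Finset X, ∀ y, F x y → ∃ z ∈ s, E z y) :
    ∃ f : X → FinSubsets X, Measurable f ∧ ∀ x y, F x y ↔ EFin E (f x) (f y) := by
  have : PolishSpace X := {}
  obtain ⟨f, hf, hfF⟩ := exists_measurable_seq_of_countable_sections hFeq.refl hFBorel hFcount
  let T (n : ℕ) : Set X := {x | ∀ m < n, ¬ E (f m x) (f n x)}
  have hT (n : ℕ) : MeasurableSet (T n) := by
    simp only [T, ofPred_forall]
    exact .iInter fun m ↦ .iInter fun _ ↦ ((hf m).prodMk (hf n) hEBorel).compl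
  have hfin (x : X) : {n | x ∈ T n}.Finite := by
    obtain ⟨s, hs⟩ := hfinindex x
    choose! r hrs hr using hs
    refine Set.Finite.of_injOn (f := fun n ↦ r (f n x)) (t := s)
      (fun n _ ↦ hrs _ ((hfF _ _).2 ⟨n, rfl⟩)) (fun n hn m hm hnm ↦ ?_) s.finite_toSet
    have hE : E (f n x) (f m x) := by
      have h := hr _ ((hfF x _).2 ⟨n, rfl⟩)
      rw [show r (f n x) = r (f m x) from hnm] at h
      exact hEeq.trans (hEeq.symm h) (hr _ ((hfF x _).2 ⟨m, rfl⟩))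
    rcases lt_trichotomy n m with h | h | h
    · exact (hm n h hE).elim
    · exact h
    · exact (hn m h (hEeq.symm hE)).elim
  obtain ⟨u, hu, hu_coe⟩ := exists_measurable_finSubsets hf hT (by simp [T]) hfin
  have hmemF {x y : X} (hy : y ∈ ((u x).1 : Set X)) : F x y := by
    rw [hu_coe] at hy
    obtain ⟨n, -, rfl⟩ := hy
    exact (hfF _ _).2 ⟨n, rfl⟩
  have hmeets {x y : X} (hxy : F x y) : ∃ z ∈ ((u x).1 : Set X), E y z := by
    classical
    have hex : ∃ n, E (f n x) y := by
      obtain ⟨n, rfl⟩ := (hfF x y).1 hxy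
      exact ⟨n, hEeq.refl _⟩
    refine ⟨f (Nat.find hex) x, ?_, hEeq.symm (Nat.find_spec hex)⟩
    rw [hu_coe]
    exact ⟨_, fun m hm h ↦ Nat.find_min hex hm (hEeq.trans h (Nat.find_spec hex)), rfl⟩
  refine ⟨u, hu, fun x y ↦ ⟨fun hxy ↦ ⟨fun z hz ↦ ?_, fun z hz ↦ ?_⟩, fun h ↦ ?_⟩⟩
  · exact hmeets (hFeq.trans (hFeq.symm hxy) (hmemF hz))
  · obtain ⟨w, hw, hzw⟩ := hmeets (hFeq.trans hxy (hmemF hz))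
    exact ⟨w, hw, hEeq.symm hzw⟩
  · obtain ⟨z, hz⟩ := (u x).1.nonempty
    obtain ⟨w, hw, hzw⟩ := h.1 z hz
    exact hFeq.trans (hmemF hz) (hFeq.trans (hsub _ _ hzw) (hFeq.symm (hmemF hw)))
end

section
/- If E is a hyperfinite Borel equivalence relation on a standard Borel (Polish) space X, then E^fin is a hyperfinite Borel equivalence relation on Fin(X). -/
open TopologicalSpace

section FinSubsets

variable {X : Type} [MetricSpace X]

theorem FinSubsets.measurableSet_inter_nonempty {U : Set X} (hU : IsOpen U) :
    MeasurableSet {u : FinSubsets X | ((u.1 : Set X) ∩ U).Nonempty} :=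
  measurable_subtype_coe
    (NonemptyCompacts.isOpen_inter_nonempty_of_isOpen hU).measurableSet

theorem FinSubsets.measurableSet_existsUnique [SecondCountableTopology X] {U : Set X}
    (hU : IsOpen U) :
    MeasurableSet {u : FinSubsets X | ∃! x, x ∈ (u.1 : Set X) ∧ x ∈ U} := by
  have key : {u : FinSubsets X | ∃! x, x ∈ (u.1 : Set X) ∧ x ∈ U} =
      {u : FinSubsets X | ((u.1 : Set X) ∩ U).Nonempty} \
        ⋃ V ∈ countableBasis X, ⋃ W ∈ countableBasis X, ⋃ _ : Disjoint V W,
          {u : FinSubsets X | ((u.1 : Set X) ∩ (U ∩ V)).Nonempty} ∩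
            {u : FinSubsets X | ((u.1 : Set X) ∩ (U ∩ W)).Nonempty} := by
    ext u
    simp only [Set.mem_ofPred_eq, Set.mem_sdiff, Set.mem_iUnion, Set.mem_inter_iff, not_exists]
    constructor
    · rintro ⟨x, hx, hux⟩
      refine ⟨⟨x, hx⟩, ?_⟩
      rintro V - W - hVW ⟨⟨y, hyu, hyU, hyV⟩, ⟨z, hzu, hzU, hzW⟩⟩
      obtain rfl := hux y ⟨hyu, hyU⟩
      obtain rfl := hux z ⟨hzu, hzU⟩
      exact Set.disjoint_left.1 hVW hyV hzW
    · rintro ⟨⟨x, hxu, hxU⟩, h⟩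
      refine ⟨x, ⟨hxu, hxU⟩, fun y hy => ?_⟩
      by_contra hne
      obtain ⟨V, W, hV, hW, hyV, hxW, hVW⟩ := t2_separation hne
      obtain ⟨V', hV', hyV', hVV'⟩ :=
        (isBasis_countableBasis X).exists_subset_of_mem_open hyV hV
      obtain ⟨W', hW', hxW', hWW'⟩ :=
        (isBasis_countableBasis X).exists_subset_of_mem_open hxW hW
      exact h V' hV' W' hW' (hVW.mono hVV' hWW')
        ⟨⟨y, hy.1, hy.2, hyV'⟩, ⟨x, hxu, hxU, hxW'⟩⟩
  rw [key]
  refine (measurableSet_inter_nonempty hU).diff ?_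
  refine .biUnion (countable_countableBasis X) fun V hV => ?_
  refine .biUnion (countable_countableBasis X) fun W hW => .iUnion fun _ => ?_
  exact (measurableSet_inter_nonempty (hU.inter (isOpen_of_mem_countableBasis hV))).inter
    (measurableSet_inter_nonempty (hU.inter (isOpen_of_mem_countableBasis hW)))

open Classical in
/-- The unique point of `u ∩ U` if there is one, and an arbitrary point of `X` otherwise. -/
noncomputable def FinSubsets.pick [Nonempty X] (U : Set X) (u : FinSubsets X) : X :=
  if h : ∃! x, x ∈ (u.1 : Set X) ∧ x ∈ U then h.choose else Classical.arbitrary X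

theorem FinSubsets.pick_mem [Nonempty X] {U : Set X} {u : FinSubsets X}
    (h : ∃! x, x ∈ (u.1 : Set X) ∧ x ∈ U) : pick U u ∈ (u.1 : Set X) ∧ pick U u ∈ U := by
  rw [pick, dif_pos h]
  exact h.choose_spec.1

theorem FinSubsets.measurable_pick [SecondCountableTopology X] [MeasurableSpace X]
    [BorelSpace X] [Nonempty X] {U : Set X} (hU : IsOpen U) : Measurable (pick U) := by
  refine measurable_of_isOpen fun W hW => ?_
  have hD := measurableSet_existsUnique hU
  have key : pick U ⁻¹' W =
      ({u : FinSubsets X | ∃! x, x ∈ (u.1 : Set X) ∧ x ∈ U} ∩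
        {u : FinSubsets X | ((u.1 : Set X) ∩ (U ∩ W)).Nonempty}) ∪
      ({u : FinSubsets X | ∃! x, x ∈ (u.1 : Set X) ∧ x ∈ U}ᶜ ∩
        {_u : FinSubsets X | Classical.arbitrary X ∈ W}) := by
    ext u
    by_cases h : ∃! x, x ∈ (u.1 : Set X) ∧ x ∈ U
    · simp only [Set.mem_preimage, Set.mem_union, Set.mem_inter_iff, Set.mem_ofPred_eq,
        Set.mem_compl_iff, h, true_and, not_true_eq_false, false_and, or_false]
      constructor
      · exact fun hW => ⟨_, (pick_mem h).1, (pick_mem h).2, hW⟩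
      · rintro ⟨y, hyu, hyU, hyW⟩
        rwa [h.unique (pick_mem h) ⟨hyu, hyU⟩]
    · simp only [Set.mem_preimage, Set.mem_union, Set.mem_inter_iff, Set.mem_ofPred_eq,
        Set.mem_compl_iff, h, pick, dif_neg, not_false_eq_true, false_and, true_and, false_or]
  rw [key]
  exact (hD.inter (measurableSet_inter_nonempty (hU.inter hW))).union
    (hD.compl.inter (.const _))

theorem FinSubsets.exists_pick_eq [SecondCountableTopology X] [Nonempty X] (u : FinSubsets X)
    {x : X} (hx : x ∈ (u.1 : Set X)) :
    ∃ U ∈ countableBasis X, (∃! y, y ∈ (u.1 : Set X) ∧ y ∈ U) ∧ pick U u = x := by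
  have hopen : IsOpen ((u.1 : Set X) \ {x})ᶜ := (u.2.sdiff).isClosed.isOpen_compl
  obtain ⟨U, hU, hxU, hsub⟩ :=
    (isBasis_countableBasis X).exists_subset_of_mem_open (a := x) (by simp) hopen
  have h : ∃! y, y ∈ (u.1 : Set X) ∧ y ∈ U := by
    refine ⟨x, ⟨hx, hxU⟩, fun y hy => ?_⟩
    by_contra hne
    exact hsub hy.2 ⟨hy.1, hne⟩
  exact ⟨U, hU, h, h.unique (pick_mem h) ⟨hx, hxU⟩⟩

theorem FinSubsets.measurableSet_forall_exists [SecondCountableTopology X] [MeasurableSpace X]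
    [BorelSpace X] {R : X → X → Prop} (hR : MeasurableSet {p : X × X | R p.1 p.2}) :
    MeasurableSet {p : FinSubsets X × FinSubsets X |
      ∀ x ∈ (p.1.1 : Set X), ∃ y ∈ (p.2.1 : Set X), R x y} := by
  rcases isEmpty_or_nonempty X with hX | hX
  · simp
  have key : {p : FinSubsets X × FinSubsets X |
      ∀ x ∈ (p.1.1 : Set X), ∃ y ∈ (p.2.1 : Set X), R x y} =
      ⋂ U ∈ countableBasis X,
        ((Prod.fst ⁻¹' {u : FinSubsets X | ∃! x, x ∈ (u.1 : Set X) ∧ x ∈ U})ᶜ ∪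
        ⋃ V ∈ countableBasis X,
          (Prod.snd ⁻¹' {v : FinSubsets X | ∃! x, x ∈ (v.1 : Set X) ∧ x ∈ V}) ∩
          ((fun p : FinSubsets X × FinSubsets X => (pick U p.1, pick V p.2)) ⁻¹'
            {p : X × X | R p.1 p.2})) := by
    ext ⟨u, v⟩
    simp only [Set.mem_ofPred_eq, Set.mem_iInter, Set.mem_union, Set.mem_compl_iff,
      Set.mem_preimage, Set.mem_iUnion, Set.mem_inter_iff, exists_prop]
    constructor
    · intro h U _
      rw [← imp_iff_not_or]
      intro hu
      obtain ⟨y, hy, hxy⟩ := h _ (pick_mem hu).1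
      obtain ⟨V, hV, hv, rfl⟩ := exists_pick_eq v hy
      exact ⟨V, hV, hv, hxy⟩
    · intro h x hx
      obtain ⟨U, hU, hu, rfl⟩ := exists_pick_eq u hx
      obtain ⟨V, -, hv, hR⟩ := (h U hU).resolve_left (not_not_intro hu)
      exact ⟨_, (pick_mem hv).1, hR⟩
  rw [key]
  refine .biInter (countable_countableBasis X) fun U hU => ?_
  have hU := isOpen_of_mem_countableBasis hU
  refine (measurable_fst (measurableSet_existsUnique hU)).compl.union ?_
  refine .biUnion (countable_countableBasis X) fun V hV => ?_
  have hV := isOpen_of_mem_countableBasis hV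
  exact (measurable_snd (measurableSet_existsUnique hV)).inter
    ((((measurable_pick hU).comp measurable_fst).prodMk
      ((measurable_pick hV).comp measurable_snd)) hR)

theorem EFin.equivalence {E : X → X → Prop} (hE : Equivalence E) : Equivalence (EFin E) where
  refl _ := ⟨fun x hx => ⟨x, hx, hE.refl x⟩, fun x hx => ⟨x, hx, hE.refl x⟩⟩
  symm h := by
    refine ⟨fun x hx => ?_, fun x hx => ?_⟩
    · obtain ⟨y, hy, hxy⟩ := h.2 x hx
      exact ⟨y, hy, hE.symm hxy⟩
    · obtain ⟨y, hy, hxy⟩ := h.1 x hx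
      exact ⟨y, hy, hE.symm hxy⟩
  trans h h' := by
    refine ⟨fun x hx => ?_, fun z hz => ?_⟩
    · obtain ⟨y, hy, hxy⟩ := h.1 x hx
      obtain ⟨z, hz, hyz⟩ := h'.1 y hy
      exact ⟨z, hz, hE.trans hxy hyz⟩
    · obtain ⟨y, hy, hyz⟩ := h'.2 z hz
      obtain ⟨x, hx, hxy⟩ := h.2 y hy
      exact ⟨x, hx, hE.trans hxy hyz⟩

theorem EFin.mono {E F : X → X → Prop} (h : ∀ x y, E x y → F x y) {u v : FinSubsets X}
    (huv : EFin E u v) : EFin F u v :=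
  ⟨fun x hx => (huv.1 x hx).imp fun _ hy => ⟨hy.1, h _ _ hy.2⟩,
    fun y hy => (huv.2 y hy).imp fun _ hx => ⟨hx.1, h _ _ hx.2⟩⟩

theorem EFin.measurableSet [SecondCountableTopology X] [MeasurableSpace X] [BorelSpace X]
    {E : X → X → Prop} (hE : MeasurableSet {p : X × X | E p.1 p.2}) :
    MeasurableSet {p : FinSubsets X × FinSubsets X | EFin E p.1 p.2} :=
  (FinSubsets.measurableSet_forall_exists hE).inter
    (measurable_swap (FinSubsets.measurableSet_forall_exists
      (R := fun x y => E y x) (measurable_swap hE)))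

theorem EFin.finite_class {E : X → X → Prop} (hE : ∀ x, {y | E x y}.Finite)
    (u : FinSubsets X) : {v : FinSubsets X | EFin E u v}.Finite := by
  refine Set.Finite.of_finite_image (f := fun v => (v.1 : Set X)) ?_
    (fun v _ w _ h => Subtype.ext (SetLike.coe_injective h))
  refine (u.2.biUnion fun x _ => hE x).finite_subsets.subset ?_
  rintro _ ⟨v, hv, rfl⟩ y hy
  obtain ⟨x, hx, hxy⟩ := hv.2 y hy
  exact Set.mem_biUnion hx hxy

theorem EFin.iff_exists {E : X → X → Prop} {F : ℕ → X → X → Prop}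
    (hmono : ∀ n x y, F n x y → F (n + 1) x y) (hE : ∀ x y, E x y ↔ ∃ n, F n x y)
    (u v : FinSubsets X) : EFin E u v ↔ ∃ n, EFin (F n) u v := by
  refine ⟨fun h => ?_, fun ⟨n, hn⟩ => hn.mono fun x y hxy => (hE x y).2 ⟨n, hxy⟩⟩
  have hle : ∀ x y, Monotone fun n => F n x y := fun x y =>
    monotone_nat_of_le_succ fun n => hmono n x y
  have h₁ : ∀ᶠ n in Filter.atTop, ∀ x ∈ (u.1 : Set X), ∃ y ∈ (v.1 : Set X), F n x y := by
    refine (u.2.eventually_all).2 fun x hx => ?_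
    obtain ⟨y, hy, hxy⟩ := h.1 x hx
    obtain ⟨n, hn⟩ := (hE x y).1 hxy
    exact Filter.eventually_atTop.2 ⟨n, fun m hm => ⟨y, hy, hle x y hm hn⟩⟩
  have h₂ : ∀ᶠ n in Filter.atTop, ∀ y ∈ (v.1 : Set X), ∃ x ∈ (u.1 : Set X), F n x y := by
    refine (v.2.eventually_all).2 fun y hy => ?_
    obtain ⟨x, hx, hxy⟩ := h.2 y hy
    obtain ⟨n, hn⟩ := (hE x y).1 hxy
    exact Filter.eventually_atTop.2 ⟨n, fun m hm => ⟨x, hx, hle x y hm hn⟩⟩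
  exact (h₁.and h₂).exists

end FinSubsets

/-- if `E` is a hyperfinite Borel equivalence relation on a Polish space `X`,
then `E^fin` is a hyperfinite Borel equivalence relation on `Fin(X)`. -/
theorem stmt12 {X : Type} [MetricSpace X] [SecondCountableTopology X] [CompleteSpace X]
    [MeasurableSpace X] [BorelSpace X]
    (E : X → X → Prop) (hEeq : Equivalence E)
    (hEBorel : MeasurableSet {p : X × X | E p.1 p.2})
    (hhyp : ∃ F : ℕ → X → X → Prop,
      (∀ n, Equivalence (F n)) ∧
      (∀ n, MeasurableSet {p : X × X | F n p.1 p.2}) ∧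
      (∀ n x, {y : X | F n x y}.Finite) ∧
      (∀ n x y, F n x y → F (n + 1) x y) ∧
      (∀ x y, E x y ↔ ∃ n, F n x y)) :
    Equivalence (EFin E) ∧
    MeasurableSet {p : FinSubsets X × FinSubsets X | EFin E p.1 p.2} ∧
    ∃ G : ℕ → FinSubsets X → FinSubsets X → Prop,
      (∀ n, Equivalence (G n)) ∧
      (∀ n, MeasurableSet {p : FinSubsets X × FinSubsets X | G n p.1 p.2}) ∧
      (∀ n u, {v : FinSubsets X | G n u v}.Finite) ∧
      (∀ n u v, G n u v → G (n + 1) u v) ∧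
      (∀ u v, EFin E u v ↔ ∃ n, G n u v) := by
  obtain ⟨F, hFeq, hFBorel, hFfin, hFmono, hEF⟩ := hhyp
  exact ⟨EFin.equivalence hEeq, EFin.measurableSet hEBorel, fun n => EFin (F n),
    fun n => EFin.equivalence (hFeq n), fun n => EFin.measurableSet (hFBorel n),
    fun n => EFin.finite_class (hFfin n), fun n _ _ => EFin.mono (hFmono n),
    EFin.iff_exists hFmono hEF⟩
end

section
/- If E is a smooth Borel equivalence relation on a standard Borel (Polish) space X, then E^fin is a smooth Borel equivalence relation on Fin(X). -/
open TopologicalSpace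

open MeasureTheory Set in
/-- The number of points of a finite set lying in a fixed open set is lower semicontinuous. -/
theorem lowerSemicontinuous_count_inter {X : Type} [MetricSpace X] [MeasurableSpace X]
    [BorelSpace X] {U : Set X} (hU : IsOpen U) :
    LowerSemicontinuous fun u : FinSubsets X => Measure.count ((u.1 : Set X) ∩ U) := by
  intro u c hc
  have hfin : ((u.1 : Set X) ∩ U).Finite := u.2.subset inter_subset_left
  obtain ⟨V, hV, hdisj⟩ := hfin.t2_separation
  have hmeet : ∀ᶠ v : FinSubsets X in nhds u,
      ∀ x ∈ (u.1 : Set X) ∩ U, ((v.1 : Set X) ∩ (V x ∩ U)).Nonempty := by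
    rw [Filter.eventually_all_finite hfin]
    intro x hx
    exact ((NonemptyCompacts.isOpen_inter_nonempty_of_isOpen ((hV x).2.inter hU)).preimage
      continuous_subtype_val).mem_nhds ⟨x, hx.1, (hV x).1, hx.2⟩
  filter_upwards [hmeet] with v hv
  refine lt_of_lt_of_le hc ?_
  beta_reduce
  have hfin' : ((v.1 : Set X) ∩ U).Finite := v.2.subset inter_subset_left
  rw [Measure.count_apply hfin.measurableSet, Measure.count_apply hfin'.measurableSet]
  have hle : ((u.1 : Set X) ∩ U).encard ≤ ((v.1 : Set X) ∩ U).encard := by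
    choose! φ hφ using hv
    refine encard_le_encard_of_injOn (f := φ) (fun x hx => ⟨(hφ x hx).1, (hφ x hx).2.2⟩) ?_
    intro x hx y hy hxy
    by_contra hne
    exact disjoint_left.1 (hdisj hx hy hne) (hφ x hx).2.1 (hxy ▸ (hφ y hy).2.1)
  exact_mod_cast hle

open MeasureTheory Set in
/-- The finite sets meeting a fixed Borel set form a Borel subset of the hyperspace. -/
theorem measurableSet_inter_nonempty {X : Type} [MetricSpace X] [MeasurableSpace X]
    [BorelSpace X] {B : Set X} (hB : MeasurableSet B) :
    MeasurableSet {u : FinSubsets X | ((u.1 : Set X) ∩ B).Nonempty} := by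
  have hfinite (u : FinSubsets X) : IsFiniteMeasure (Measure.count.restrict (u.1 : Set X)) :=
    isFiniteMeasure_restrict.2 (Measure.count_apply_lt_top.2 u.2).ne
  have hopen (U : Set X) (hU : IsOpen U) :
      Measurable fun u : FinSubsets X => Measure.count.restrict (u.1 : Set X) U := by
    simp_rw [Measure.restrict_apply hU.measurableSet, inter_comm U]
    exact (lowerSemicontinuous_count_inter hU).measurable
  have hmeas : Measurable fun u : FinSubsets X => Measure.count.restrict (u.1 : Set X) :=
    .measure_of_isPiSystem (BorelSpace.measurable_eq (α := X)) isPiSystem_isOpen hopen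
      (hopen univ isOpen_univ)
  convert (((Measure.measurable_coe hB).comp hmeas) (measurableSet_singleton 0)).compl using 1
  ext u
  simp [Measure.restrict_apply hB, inter_comm B, nonempty_iff_ne_empty]

theorem eFin_iff_image_eq {X : Type} [MetricSpace X] {E : X → X → Prop} {Y : Type*} {f : X → Y}
    (hf : ∀ x y, E x y ↔ f x = f y) (u v : FinSubsets X) :
    EFin E u v ↔ f '' (u.1 : Set X) = f '' (v.1 : Set X) := by
  rw [Set.Subset.antisymm_iff, Set.image_subset_iff, Set.image_subset_iff]
  simp only [EFin, hf, Set.subset_def, Set.mem_preimage, Set.mem_image, eq_comm]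

/-- A closed set is determined by the members of a topological basis that it meets. -/
theorem TopologicalSpace.IsTopologicalBasis.subset_of_inter_nonempty {Y : Type*}
    [TopologicalSpace Y] {b : Set (Set Y)} (hb : IsTopologicalBasis b) {s t : Set Y}
    (ht : IsClosed t) (h : ∀ U ∈ b, (s ∩ U).Nonempty → (t ∩ U).Nonempty) : s ⊆ t := by
  intro y hy
  by_contra hyt
  obtain ⟨U, hU, hyU, hUt⟩ := hb.exists_subset_of_mem_open hyt ht.isOpen_compl
  obtain ⟨z, hzt, hzU⟩ := h U hU ⟨y, hy, hyU⟩
  exact hUt hzU hzt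

/-- if `E` is a smooth Borel equivalence relation on a Polish space `X`
(i.e. Borel reducible to the identity on `ℝ`), then `E^fin` is a smooth Borel equivalence
relation on `Fin(X)`. -/
theorem stmt13 {X : Type} [MetricSpace X] [SecondCountableTopology X] [CompleteSpace X]
    [MeasurableSpace X] [BorelSpace X]
    (E : X → X → Prop) (hEeq : Equivalence E)
    (hEBorel : MeasurableSet {p : X × X | E p.1 p.2})
    (hsmooth : ∃ f : X → ℝ, Measurable f ∧ ∀ x y, E x y ↔ f x = f y) :
    Equivalence (EFin E) ∧
    MeasurableSet {p : FinSubsets X × FinSubsets X | EFin E p.1 p.2} ∧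
    ∃ g : FinSubsets X → ℝ, Measurable g ∧ ∀ u v, EFin E u v ↔ g u = g v := by
  obtain ⟨f, hf, hfE⟩ := hsmooth
  have hiff := eFin_iff_image_eq hfE
  let b := countableBasis ℝ
  have : Countable b := (countable_countableBasis ℝ).to_subtype
  let m : FinSubsets X → b → Prop := fun u U => ((u.1 : Set X) ∩ f ⁻¹' (U : Set ℝ)).Nonempty
  have hm : Measurable m := measurable_pi_iff.2 fun U => measurableSet_setOfPred.1 <|
    measurableSet_inter_nonempty (hf (isOpen_of_mem_countableBasis U.2).measurableSet)
  have hsub (u v : FinSubsets X) (h : m u = m v) :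
      f '' (u.1 : Set X) ⊆ f '' (v.1 : Set X) := by
    refine (isBasis_countableBasis ℝ).subset_of_inter_nonempty (v.2.image f).isClosed ?_
    intro U hU hne
    rw [Set.image_inter_nonempty_iff] at hne ⊢
    exact (congrFun h ⟨U, hU⟩).mp hne
  have hme (u v : FinSubsets X) : EFin E u v ↔ m u = m v := by
    refine (hiff u v).trans ⟨fun h => ?_, fun h => (hsub u v h).antisymm (hsub v u h.symm)⟩
    funext U
    simp only [m, ← Set.image_inter_nonempty_iff, h]
  have hemb := MeasureTheory.measurableEmbedding_embeddingReal (b → Prop)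
  let g : FinSubsets X → ℝ := fun u => MeasureTheory.embeddingReal (b → Prop) (m u)
  have hg : Measurable g := hemb.measurable.comp hm
  have hge (u v : FinSubsets X) : EFin E u v ↔ g u = g v :=
    (hme u v).trans hemb.injective.eq_iff.symm
  refine ⟨⟨fun u => (hge u u).2 rfl, fun h => (hge _ _).2 ((hge _ _).1 h).symm,
    fun h h' => (hge _ _).2 (((hge _ _).1 h).trans ((hge _ _).1 h'))⟩, ?_, g, hg, hge⟩
  simp only [hge]
  exact measurableSet_eq_fun (hg.comp measurable_fst) (hg.comp measurable_snd)
end
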